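/- arXiv:2403.13383 — 4 statements merged into one kernel-verified Lean document; each statement's English description precedes it below -/
import Mathlib

section
/- The quantity log h_K(γ) / log T converges in probability to 1 as T → ∞, where h_K(γ) is the class number of the real quadratic field K(γ) = ℚ(√(Tr(γ)²−4)): for every η > 0, lim_{T→∞} ℙ_T({γ ∈ Γ_T : |Tr(γ)| > 2 and |log h_K(γ)/log T − 1| ≤ η}) = 1. -/
noncomputable section

open Matrix Filter Topology

/-- `Γ = SL(2,ℤ)`. -/
abbrev SL2Z := Matrix.SpecialLinearGroup (Fin 2) ℤ

/-- Frobenius norm of a matrix in `SL(2,ℤ)`. -/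
noncomputable def frobNorm (γ : SL2Z) : ℝ :=
  Real.sqrt ((γ 0 0 ^ 2 + γ 0 1 ^ 2 + γ 1 0 ^ 2 + γ 1 1 ^ 2 : ℤ) : ℝ)

/-- Trace of a matrix in `SL(2,ℤ)`. -/
def trZ (γ : SL2Z) : ℤ := γ 0 0 + γ 1 1

/-- The class number of the real quadratic field `K(γ) = ℚ(√(Tr(γ)²-4))`, viewed as a
subfield of `ℝ`: the cardinality of the class group of its ring of integers. -/
noncomputable def hK (γ : SL2Z) : ℕ :=
  Nat.card (ClassGroup (NumberField.RingOfIntegers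
    ↥(IntermediateField.adjoin ℚ {Real.sqrt ((trZ γ : ℝ) ^ 2 - 4)})))

theorem succ_le_mul_two_rpow {ε : ℝ} (hε : 0 < ε) (k : ℕ) :
    (k : ℝ) + 1 ≤ (1 / (ε * Real.log 2) + 1) * (2 : ℝ) ^ (ε * k) := by
  have hl : 0 < Real.log 2 := Real.log_pos (by norm_num)
  have hεl : 0 < ε * Real.log 2 := by positivity
  have h1 : ε * Real.log 2 * k + 1 ≤ (2 : ℝ) ^ (ε * k) := by
    rw [Real.rpow_def_of_pos (by norm_num)]
    have := Real.add_one_le_exp (Real.log 2 * (ε * k))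
    linarith
  have h2 : (1 : ℝ) ≤ (2 : ℝ) ^ (ε * k) := Real.one_le_rpow (by norm_num) (by positivity)
  have h3 : (k : ℝ) ≤ 1 / (ε * Real.log 2) * (2 : ℝ) ^ (ε * k) := by
    rw [div_mul_eq_mul_div, one_mul, le_div_iff₀ hεl]
    linarith
  linarith

/-- The divisor bound: `d(n) = O(n ^ ε)` for every `ε > 0`. -/
theorem exists_card_divisors_le_rpow {ε : ℝ} (hε : 0 < ε) :
    ∃ C : ℝ, 1 ≤ C ∧ ∀ n : ℕ, n ≠ 0 → (n.divisors.card : ℝ) ≤ C * (n : ℝ) ^ ε := by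
  set A : ℝ := 1 / (ε * Real.log 2) + 1 with hA
  have hl : 0 < Real.log 2 := Real.log_pos (by norm_num)
  have hA1 : 1 ≤ A := by
    have : 0 < 1 / (ε * Real.log 2) := by positivity
    linarith
  set P : ℕ := ⌈(2 : ℝ) ^ (1 / ε)⌉₊ with hP
  refine ⟨A ^ P, one_le_pow₀ hA1, fun n hn => ?_⟩
  have hterm : ∀ p ∈ n.primeFactors, ((n.factorization p : ℝ) + 1) ≤
      (if p < P then A else 1) * ((p : ℝ) ^ (n.factorization p)) ^ ε := by
    intro p hp
    have hpp := Nat.prime_of_mem_primeFactors hp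
    have hp2 : (2 : ℝ) ≤ p := by exact_mod_cast hpp.two_le
    set k := n.factorization p
    have hpk : ((p : ℝ) ^ k) ^ ε = (p : ℝ) ^ (ε * k) := by
      rw [← Real.rpow_natCast, ← Real.rpow_mul (by positivity), mul_comm]
    rw [hpk]
    split_ifs with h
    · refine (succ_le_mul_two_rpow hε k).trans ?_
      gcongr
    · rw [one_mul]
      have h2 : (2 : ℝ) ≤ (p : ℝ) ^ ε := by
        have : (2 : ℝ) ^ (1 / ε) ≤ p := (Nat.le_ceil _).trans (by exact_mod_cast not_lt.mp h)
        calc (2 : ℝ) = ((2 : ℝ) ^ (1 / ε)) ^ ε := by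
              rw [← Real.rpow_mul (by norm_num)]; field_simp; simp
          _ ≤ _ := by gcongr
      rw [Real.rpow_mul (by positivity), Real.rpow_natCast]
      calc (k : ℝ) + 1 ≤ 2 ^ k := by exact_mod_cast Nat.lt_two_pow_self
        _ ≤ _ := by gcongr
  rw [Nat.card_divisors hn]
  push_cast
  calc ∏ p ∈ n.primeFactors, ((n.factorization p : ℝ) + 1)
      ≤ ∏ p ∈ n.primeFactors, (if p < P then A else 1) * ((p : ℝ) ^ (n.factorization p)) ^ ε :=
        Finset.prod_le_prod (fun _ _ => by positivity) hterm
    _ = (∏ p ∈ n.primeFactors, if p < P then A else 1) * (n : ℝ) ^ ε := by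
        rw [Finset.prod_mul_distrib, Real.finsetProd_rpow _ _ (fun _ _ => by positivity)]
        congr 2
        conv_rhs => rw [← Nat.prod_factorization_pow_eq_self hn]
        simp [Finsupp.prod]
    _ ≤ A ^ P * (n : ℝ) ^ ε := by
        gcongr
        rw [Finset.prod_ite, Finset.prod_const_one, mul_one, Finset.prod_const]
        refine pow_le_pow_right₀ hA1 ?_
        calc _ ≤ (Finset.range P).card := Finset.card_le_card (by intro; simp)
          _ = P := Finset.card_range P

theorem le_card_divisors_mul_totient {n : ℕ} (hn : n ≠ 0) :
    n ≤ n.divisors.card * n.totient := by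
  conv_lhs => rw [← Nat.sum_totient n]
  refine (Finset.sum_le_card_nsmul _ _ n.totient fun d hd => ?_).trans_eq (by simp)
  exact Nat.le_of_dvd (Nat.totient_pos.2 (Nat.pos_of_ne_zero hn))
    (Nat.totient_dvd_of_dvd (Nat.dvd_of_mem_divisors hd))

theorem finite_and_ncard_le_of_injOn {α β : Type*} {S : Set α} (f : α → β) (F : Finset β)
    (hm : ∀ x ∈ S, f x ∈ F) (hi : Set.InjOn f S) : S.Finite ∧ S.ncard ≤ F.card := by
  have hfin : S.Finite := Set.Finite.of_finite_image (F.finite_toSet.subset (by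
    rintro _ ⟨x, hx, rfl⟩; exact hm x hx)) hi
  refine ⟨hfin, ?_⟩
  rw [← Set.ncard_coe_finset F]
  exact Set.ncard_le_ncard_of_injOn f hm hi F.finite_toSet

theorem SL2Z.det_eq (γ : SL2Z) : γ 0 0 * γ 1 1 - γ 0 1 * γ 1 0 = 1 := by
  have := γ.2
  rwa [Matrix.det_fin_two] at this

theorem SL2Z.ext_entries {γ δ : SL2Z} (h₀ : γ 0 0 = δ 0 0) (h₁ : γ 0 1 = δ 0 1)
    (h₂ : γ 1 0 = δ 1 0) (h₃ : γ 1 1 = δ 1 1) : γ = δ := by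
  apply Matrix.SpecialLinearGroup.ext
  intro i j
  fin_cases i <;> fin_cases j <;> assumption

theorem SL2Z.ext_of_lower_left_ne_zero {γ δ : SL2Z} (hc : γ 1 0 ≠ 0) (h₀ : γ 0 0 = δ 0 0)
    (h₂ : γ 1 0 = δ 1 0) (h₃ : γ 1 1 = δ 1 1) : γ = δ := by
  refine SL2Z.ext_entries h₀ ?_ h₂ h₃
  have h := γ.det_eq
  have h' := δ.det_eq
  rw [← h₀, ← h₂, ← h₃] at h'
  exact mul_right_cancel₀ hc (by linarith)

theorem sq_frobNorm (γ : SL2Z) :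
    frobNorm γ ^ 2 = (γ 0 0 : ℝ) ^ 2 + (γ 0 1 : ℝ) ^ 2 + (γ 1 0 : ℝ) ^ 2 + (γ 1 1 : ℝ) ^ 2 := by
  rw [frobNorm, Real.sq_sqrt]
  · push_cast; ring
  · exact_mod_cast (by positivity : 0 ≤ γ 0 0 ^ 2 + γ 0 1 ^ 2 + γ 1 0 ^ 2 + γ 1 1 ^ 2)

theorem frobNorm_nonneg (γ : SL2Z) : 0 ≤ frobNorm γ := Real.sqrt_nonneg _

theorem abs_entry_le_frobNorm (γ : SL2Z) (i j : Fin 2) : |(γ i j : ℝ)| ≤ frobNorm γ := by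
  refine abs_le_of_sq_le_sq ?_ (frobNorm_nonneg γ)
  rw [sq_frobNorm]
  fin_cases i <;> fin_cases j <;> simp <;> nlinarith [sq_nonneg (γ 0 0 : ℝ), sq_nonneg (γ 0 1 : ℝ),
    sq_nonneg (γ 1 0 : ℝ), sq_nonneg (γ 1 1 : ℝ)]

theorem abs_entry_le_floor {γ : SL2Z} {T : ℝ} (h : frobNorm γ ≤ T) (i j : Fin 2) :
    |γ i j| ≤ (⌊T⌋₊ : ℤ) := by
  have h1 : ((|γ i j|.toNat : ℕ) : ℝ) ≤ T := by
    have : ((|γ i j|.toNat : ℕ) : ℤ) = |γ i j| := Int.toNat_of_nonneg (abs_nonneg _)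
    have h2 : ((|γ i j|.toNat : ℕ) : ℝ) = |(γ i j : ℝ)| := by
      rw [← Int.cast_abs]; exact_mod_cast this
    rw [h2]
    exact (abs_entry_le_frobNorm γ i j).trans h
  have := Nat.le_floor h1
  omega

theorem finite_frobNorm_le (T : ℝ) : {γ : SL2Z | frobNorm γ ≤ T}.Finite := by
  set I := Finset.Icc (-(⌊T⌋₊ : ℤ)) ⌊T⌋₊
  refine (finite_and_ncard_le_of_injOn (fun γ : SL2Z => (γ 0 0, γ 0 1, γ 1 0, γ 1 1))
    (I ×ˢ I ×ˢ I ×ˢ I) ?_ ?_).1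
  · intro γ hγ
    have h := fun i j => abs_le.1 (abs_entry_le_floor hγ i j)
    simp [I, h]
  · intro γ _ δ _ h
    simp only [Prod.mk.injEq] at h
    exact SL2Z.ext_entries h.1 h.2.1 h.2.2.1 h.2.2.2

/-- The number of matrices of given trace with bounded upper left entry. -/
theorem ncard_trZ_eq_le {ε C : ℝ} (hε : 0 ≤ ε)
    (hC : ∀ n : ℕ, n ≠ 0 → (n.divisors.card : ℝ) ≤ C * (n : ℝ) ^ ε) (hC0 : 1 ≤ C)
    {N : ℕ} (hN : 1 ≤ N) {t : ℤ} (ht : |t| ≤ 2 * N) :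
    {γ : SL2Z | trZ γ = t ∧ γ 0 0 * γ 1 1 ≠ 1 ∧ |γ 0 0| ≤ N}.Finite ∧
    (({γ : SL2Z | trZ γ = t ∧ γ 0 0 * γ 1 1 ≠ 1 ∧ |γ 0 0| ≤ N}.ncard : ℕ) : ℝ) ≤
      (2 * N + 1) * (2 * (C * (4 * (N : ℝ) ^ 2) ^ ε)) := by
  set F : Finset (Σ _ : ℤ, ℕ × ℤ) := (Finset.Icc (-(N : ℤ)) N).sigma
    fun a => (a * (t - a) - 1).natAbs.divisors ×ˢ {1, -1}
  have key := finite_and_ncard_le_of_injOn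
    (S := {γ : SL2Z | trZ γ = t ∧ γ 0 0 * γ 1 1 ≠ 1 ∧ |γ 0 0| ≤ N})
    (fun γ => (⟨γ 0 0, (γ 1 0).natAbs, (γ 1 0).sign⟩ : Σ _ : ℤ, ℕ × ℤ)) F ?_ ?_
  · refine ⟨key.1, (Nat.cast_le.2 key.2).trans ?_⟩
    rw [Finset.card_sigma]
    push_cast
    refine (Finset.sum_le_card_nsmul _ _ (2 * (C * (4 * (N : ℝ) ^ 2) ^ ε)) ?_).trans_eq ?_
    · intro a ha
      rw [Finset.mem_Icc] at ha
      rw [Finset.card_product]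
      push_cast
      have hcard : (({1, -1} : Finset ℤ).card : ℝ) = 2 := by norm_num
      rw [hcard, mul_comm]
      refine mul_le_mul_of_nonneg_left ?_ (by norm_num)
      by_cases h0 : (a * (t - a) - 1).natAbs = 0
      · rw [h0]
        simp
        positivity
      · refine (hC _ h0).trans ?_
        have : (((a * (t - a) - 1).natAbs : ℕ) : ℝ) ≤ 4 * (N : ℝ) ^ 2 := by
          have h1 : |a * (t - a) - 1| ≤ 4 * (N : ℤ) ^ 2 := by
            have hN' : (1 : ℤ) ≤ N := by exact_mod_cast hN
            have h2 : |a| ≤ N := abs_le.2 ha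
            calc |a * (t - a) - 1| ≤ |a * (t - a)| + |1| := abs_sub _ _
              _ ≤ |a| * (|t| + |a|) + 1 := by
                rw [abs_mul]; gcongr; exact abs_sub _ _; simp
              _ ≤ N * (2 * N + N) + 1 := by gcongr
              _ ≤ _ := by nlinarith
          have h3 : (((a * (t - a) - 1).natAbs : ℕ) : ℤ) ≤ 4 * (N : ℤ) ^ 2 := by
            rwa [Int.natCast_natAbs]
          exact_mod_cast h3
        gcongr
    · simp
      left
      have : ((N : ℤ) + 1 + N).toNat = 2 * N + 1 := by omega
      rw [this]; push_cast; ring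
  · rintro γ ⟨h1, h2, h3⟩
    have hdet := γ.det_eq
    have hbc : γ 0 0 * (t - γ 0 0) - 1 = γ 0 1 * γ 1 0 := by
      rw [← h1, trZ]; linarith
    have hne : γ 0 1 * γ 1 0 ≠ 0 := by
      intro h; apply h2; linarith
    simp only [F, Finset.mem_sigma, Finset.mem_Icc, Finset.mem_product, Nat.mem_divisors]
    refine ⟨abs_le.1 h3, ⟨?_, ?_⟩, ?_⟩
    · rw [hbc, Int.natAbs_mul]; exact Dvd.intro_left _ rfl
    · rw [hbc]; simpa using hne
    · rcases lt_trichotomy (γ 1 0) 0 with h | h | h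
      · simp [Int.sign_eq_neg_one_of_neg h]
      · simp [h] at hne
      · simp [Int.sign_eq_one_of_pos h]
  · rintro γ ⟨h1, h2, h3⟩ δ ⟨h1', h2', h3'⟩ h
    simp only [Sigma.mk.injEq, heq_eq_eq, Prod.mk.injEq] at h
    obtain ⟨ha, hc, hs⟩ := h
    have hdet := γ.det_eq
    refine SL2Z.ext_of_lower_left_ne_zero ?_ ha ?_ ?_
    · intro h0; apply h2; rw [h0] at hdet; linarith
    · rw [← Int.sign_mul_natAbs (γ 1 0), hs, hc, Int.sign_mul_natAbs]
    · rw [trZ] at h1 h1'; linarith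

theorem ncard_diag_mul_eq_one_le (N : ℕ) :
    {γ : SL2Z | γ 0 0 * γ 1 1 = 1 ∧ ∀ i j, |γ i j| ≤ N}.ncard ≤ 4 * (2 * N + 1) := by
  classical
  refine (finite_and_ncard_le_of_injOn
    (fun γ : SL2Z => (γ 0 0, (if γ 0 1 = 0 then γ 1 0 else γ 0 1), decide (γ 0 1 = 0)))
    (({1, -1} : Finset ℤ) ×ˢ Finset.Icc (-(N : ℤ)) N ×ˢ Finset.univ) ?_ ?_).2.trans ?_
  · rintro γ ⟨h1, h2⟩
    have h := fun i j => abs_le.1 (h2 i j)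
    simp only [Finset.mem_product, Finset.mem_insert, Finset.mem_singleton, Finset.mem_Icc,
      Finset.mem_univ, and_true]
    refine ⟨Int.eq_one_or_neg_one_of_mul_eq_one h1, ?_⟩
    split_ifs
    exacts [h _ _, h _ _]
  · rintro γ ⟨h1, h2⟩ δ ⟨h1', h2'⟩ h
    simp only [Prod.mk.injEq, decide_eq_decide] at h
    obtain ⟨ha, hb, hz⟩ := h
    have hdet := γ.det_eq
    have hdet' := δ.det_eq
    have hbc : γ 0 1 * γ 1 0 = 0 := by linarith
    have hbc' : δ 0 1 * δ 1 0 = 0 := by linarith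
    have hd : γ 1 1 = δ 1 1 := by
      have h0 : γ 0 0 ≠ 0 := by rintro h0; simp [h0] at h1
      rw [← ha] at h1'
      exact mul_left_cancel₀ h0 (by linarith)
    by_cases hb0 : γ 0 1 = 0
    · have hb0' := hz.1 hb0
      rw [if_pos hb0, if_pos hb0'] at hb
      exact SL2Z.ext_entries ha (by rw [hb0, hb0']) hb hd
    · have hb0' : δ 0 1 ≠ 0 := fun h => hb0 (hz.2 h)
      rw [if_neg hb0, if_neg hb0'] at hb
      refine SL2Z.ext_entries ha hb ?_ hd
      rw [(mul_eq_zero.1 hbc).resolve_left hb0, (mul_eq_zero.1 hbc').resolve_left hb0']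
  · simp only [Finset.card_product, Int.card_Icc, Finset.card_univ, Fintype.card_bool]
    have : (({1, -1} : Finset ℤ).card) = 2 := by decide
    rw [this]
    omega

theorem exists_SL2Z_of_coprime {m n : ℕ} (hmn : m < n) (hc : n.Coprime m) :
    ∃ γ : SL2Z, γ 0 0 = m ∧ γ 1 0 = n ∧ frobNorm γ ≤ 2 * n := by
  obtain ⟨u, v, huv⟩ := Nat.isCoprime_iff_coprime.2 hc
  have hn : (0 : ℤ) < n := by omega
  have hm : (0 : ℤ) ≤ m := by omega
  have hmn' : (m : ℤ) + 1 ≤ n := by omega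
  set d := v % n with hd
  have hd0 : 0 ≤ d := Int.emod_nonneg _ hn.ne'
  have hd1 : d + 1 ≤ n := Int.emod_lt_of_pos _ hn
  have hv := Int.emod_add_mul_ediv v n
  set q := v / n
  set b := - u - q * m with hb
  have hdet : m * d - b * n = 1 := by
    rw [hb, ← huv, ← hv]; ring
  obtain ⟨γ, e₀, e₁, e₂, e₃⟩ : ∃ γ : SL2Z, γ 0 0 = m ∧ γ 0 1 = b ∧ γ 1 0 = n ∧ γ 1 1 = d :=
    ⟨⟨!![(m : ℤ), b; n, d], by rw [Matrix.det_fin_two]; simpa using hdet⟩, by simp⟩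
  refine ⟨γ, e₀, e₂, ?_⟩
  have hb1 : b ≤ n := by nlinarith
  have hb2 : -b ≤ n := by nlinarith
  have h4 : (m : ℤ) ^ 2 + b ^ 2 + n ^ 2 + d ^ 2 ≤ (2 * n) ^ 2 := by nlinarith
  refine (abs_le_of_sq_le_sq' ?_ (by positivity)).2
  rw [sq_frobNorm, e₀, e₁, e₂, e₃]
  exact_mod_cast h4

theorem sum_totient_le_ncard (N : ℕ) :
    ∑ n ∈ Finset.Icc 1 N, n.totient ≤ {γ : SL2Z | frobNorm γ ≤ 2 * N}.ncard := by
  classical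
  set F : Finset (Σ _ : ℕ, ℕ) := (Finset.Icc 1 N).sigma
    fun n => (Finset.range n).filter n.Coprime
  have hF : F.card = ∑ n ∈ Finset.Icc 1 N, n.totient := by
    rw [Finset.card_sigma]; rfl
  have hex : ∀ x : Σ _ : ℕ, ℕ, ∃ γ : SL2Z, x ∈ F →
      γ 0 0 = x.2 ∧ γ 1 0 = x.1 ∧ frobNorm γ ≤ 2 * x.1 := by
    intro x
    by_cases hx : x ∈ F
    · simp only [F, Finset.mem_sigma, Finset.mem_filter, Finset.mem_range] at hx
      obtain ⟨γ, hγ⟩ := exists_SL2Z_of_coprime hx.2.1 hx.2.2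
      exact ⟨γ, fun _ => hγ⟩
    · exact ⟨1, fun h => absurd h hx⟩
  choose f hf using hex
  rw [← hF, ← Set.ncard_coe_finset F]
  refine Set.ncard_le_ncard_of_injOn f ?_ ?_ (finite_frobNorm_le _)
  · intro x hx
    refine (hf x hx).2.2.trans ?_
    simp only [F, Finset.coe_sigma, Set.mem_sigma_iff, Finset.mem_coe, Finset.mem_Icc] at hx
    have : (x.1 : ℝ) ≤ N := by exact_mod_cast hx.1.2
    linarith
  · intro x hx y hy hxy
    have h1 := hf x hx
    have h2 := hf y hy
    rw [hxy] at h1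
    have e1 : x.1 = y.1 := by exact_mod_cast h1.2.1.symm.trans h2.2.1
    have e2 : x.2 = y.2 := by exact_mod_cast h1.1.symm.trans h2.1
    exact Sigma.ext e1 (heq_of_eq e2)

open NumberField nonZeroDivisors

/-- The class of the ideal generated by an eigenvector of `γ` for the eigenvalue `θ`. -/
def eigClass {K : Type*} [Field K] [NumberField K] (θ : 𝓞 K) (γ : SL2Z) : ClassGroup (𝓞 K) :=
  open Classical in
  if h : Ideal.span {θ - (γ 1 1 : 𝓞 K), (γ 1 0 : 𝓞 K)} ∈ (Ideal (𝓞 K))⁰ then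
    ClassGroup.mk0 ⟨_, h⟩ else 1

theorem exists_abs_sub_two_mul_le (x : ℤ) {c : ℤ} (hc : c ≠ 0) :
    ∃ k : ℤ, |x - 2 * k * c| ≤ |c| := by
  have h2c : 0 < 2 * |c| := by positivity
  have hr0 : 0 ≤ (x + |c|) % (2 * |c|) := Int.emod_nonneg _ h2c.ne'
  have hr1 : (x + |c|) % (2 * |c|) < 2 * |c| := Int.emod_lt_of_pos _ h2c
  have hr := Int.emod_add_mul_ediv (x + |c|) (2 * |c|)
  refine ⟨(x + |c|) / (2 * |c|) * c.sign, ?_⟩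
  have hs : c.sign * c = |c| := by rw [mul_comm, Int.mul_sign_self, Int.natCast_natAbs]
  rw [abs_le]
  have : 2 * ((x + |c|) / (2 * |c|) * c.sign) * c = 2 * |c| * ((x + |c|) / (2 * |c|)) := by
    rw [← hs]; ring
  rw [this]
  constructor <;> linarith

theorem reduced_bounds {a b c d : ℤ} (hdet : a * d - b * c = 1) (hc : c ≠ 0) (hle : |c| ≤ |b|)
    (hda : |d - a| ≤ |c|) (ht : 2 < |a + d|) : a * d ≠ 1 ∧ |a| ≤ |a + d| := by
  have hD : (d - a) ^ 2 + 4 * (b * c) = (a + d) ^ 2 - 4 := by linarith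
  have hsq : (d - a) ^ 2 ≤ |c| ^ 2 := sq_le_sq' (abs_le.1 hda).1 (abs_le.1 hda).2
  have hc1 : 1 ≤ |c| := Int.one_le_abs hc
  have ht2 : 9 ≤ (a + d) ^ 2 := by rw [← sq_abs]; nlinarith
  have hbc : |b * c| = |b| * |c| := abs_mul _ _
  have hcb : |c| * |c| ≤ |b| * |c| := by gcongr
  have hpos : 0 ≤ b * c := by
    by_contra! hneg
    rw [abs_of_neg hneg] at hbc
    nlinarith
  rw [abs_of_nonneg hpos] at hbc
  have h2c : 2 * |c| ≤ |a + d| := by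
    refine (abs_le_of_sq_le_sq' ?_ (abs_nonneg _)).2
    rw [sq_abs]
    nlinarith [sq_nonneg (d - a)]
  refine ⟨fun h1 => ?_, ?_⟩
  · nlinarith
  · have h1 := abs_le.1 hda
    have h2 := neg_abs_le (a + d)
    have h3 := le_abs_self (a + d)
    rw [abs_le]
    constructor <;> linarith

section EigClass

variable {K : Type*} [Field K] {θ : 𝓞 K}

theorem sub_intCast_ne_zero (irr : ∀ m n : ℤ, (m : 𝓞 K) * θ = n → m = 0) (d : ℤ) :
    θ - (d : 𝓞 K) ≠ 0 := by
  intro h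
  have := irr 1 d (by rw [sub_eq_zero] at h; simpa using h)
  omega

variable [NumberField K] {t : ℤ}

theorem eq_zero_of_mul_eq (irr : ∀ m n : ℤ, (m : 𝓞 K) * θ = n → m = 0) {m n : ℤ}
    (h : (m : 𝓞 K) * θ = n) : m = 0 ∧ n = 0 := by
  have hm := irr m n h
  subst hm
  refine ⟨rfl, ?_⟩
  have : ((n : ℤ) : 𝓞 K) = 0 := by rw [← h]; simp
  exact_mod_cast this

theorem mk0_eq_eigClass (irr : ∀ m n : ℤ, (m : 𝓞 K) * θ = n → m = 0) {γ : SL2Z} {x y : 𝓞 K}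
    (hy : y ≠ 0) (h : (γ 1 0 : 𝓞 K) * x = (θ - (γ 1 1 : 𝓞 K)) * y) {J : (Ideal (𝓞 K))⁰}
    (hJ : Ideal.span {x, y} = (J : Ideal (𝓞 K))) :
    ClassGroup.mk0 J = eigClass θ γ := by
  have hd := sub_intCast_ne_zero irr (γ 1 1)
  have hI : Ideal.span {θ - (γ 1 1 : 𝓞 K), (γ 1 0 : 𝓞 K)} ∈ (Ideal (𝓞 K))⁰ := by
    rw [mem_nonZeroDivisors_iff_ne_zero]
    intro h0
    rw [Ideal.zero_eq_bot, Ideal.span_eq_bot] at h0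
    exact hd (h0 _ (by simp))
  have hc : (γ 1 0 : 𝓞 K) ≠ 0 := by
    intro h0
    rw [h0, zero_mul] at h
    exact mul_ne_zero hd hy h.symm
  rw [eigClass, dif_pos hI, ClassGroup.mk0_eq_mk0_iff]
  refine ⟨(γ 1 0 : 𝓞 K), y, hc, hy, ?_⟩
  rw [← hJ]
  simp only [Ideal.span_mul_span', Set.singleton_mul, Set.image_pair]
  rw [h, mul_comm (θ - _) y, mul_comm _ y]

theorem exists_trZ_eq_of_class (hθ : θ ^ 2 = t * θ - 1)
    (irr : ∀ m n : ℤ, (m : 𝓞 K) * θ = n → m = 0)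
    (hrank : Module.finrank ℚ K = 2) (J : (Ideal (𝓞 K))⁰) :
    ∃ γ : SL2Z, ∃ x y : 𝓞 K, trZ γ = t ∧ y ≠ 0 ∧
      (γ 1 0 : 𝓞 K) * x = (θ - (γ 1 1 : 𝓞 K)) * y ∧
      Ideal.span {x, y} = (J : Ideal (𝓞 K)) := by
  have hr : Module.finrank ℤ (𝓞 K) = 2 := by rw [RingOfIntegers.rank, hrank]
  have hJ : (J : Ideal (𝓞 K)) ≠ ⊥ := mem_nonZeroDivisors_iff_ne_zero.1 J.2
  set b := Ideal.selfBasis (Module.finBasisOfFinrankEq ℤ (𝓞 K) hr) (J : Ideal (𝓞 K)) hJ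
  set e : Fin 2 → 𝓞 K := fun i => (b i : 𝓞 K) with he
  have hmem : ∀ z ∈ (J : Ideal (𝓞 K)), ∃ m n : ℤ, z = m * e 0 + n * e 1 := by
    intro z hz
    refine ⟨b.repr ⟨z, hz⟩ 0, b.repr ⟨z, hz⟩ 1, ?_⟩
    have h := congrArg (Subtype.val) (b.sum_repr ⟨z, hz⟩)
    simp only [Fin.sum_univ_two] at h
    simpa [he] using h.symm
  have hspan : Ideal.span {e 0, e 1} = (J : Ideal (𝓞 K)) := by
    apply le_antisymm
    · rw [Ideal.span_le]
      rintro _ (rfl | rfl)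
      exacts [(b 0).2, (b 1).2]
    · intro z hz
      obtain ⟨m, n, rfl⟩ := hmem z hz
      rw [Ideal.mem_span_pair]
      exact ⟨m, n, rfl⟩
  have hy : e 1 ≠ 0 := by
    intro h
    exact b.ne_zero 1 (Subtype.ext h)
  obtain ⟨p, q, hpq⟩ := hmem (θ * e 0) (Ideal.mul_mem_left _ _ (b 0).2)
  obtain ⟨c, d, hcd⟩ := hmem (θ * e 1) (Ideal.mul_mem_left _ _ (b 1).2)
  have key : ((p + d - t : ℤ) : 𝓞 K) * θ = ((p * d - q * c - 1 : ℤ) : 𝓞 K) := by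
    have h1 : (((p + d - t : ℤ) : 𝓞 K) * θ - ((p * d - q * c - 1 : ℤ) : 𝓞 K)) * e 1 = 0 := by
      push_cast
      linear_combination (-(c : 𝓞 K)) * hpq + e 1 * hθ + ((p : 𝓞 K) - θ) * hcd
    exact sub_eq_zero.1 ((mul_eq_zero.1 h1).resolve_right hy)
  obtain ⟨k1, k2⟩ := eq_zero_of_mul_eq irr key
  obtain ⟨γ, e₀, e₁, e₂, e₃⟩ : ∃ γ : SL2Z, γ 0 0 = p ∧ γ 0 1 = q ∧ γ 1 0 = c ∧ γ 1 1 = d :=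
    ⟨⟨!![p, q; c, d], by rw [Matrix.det_fin_two]; simp; linarith⟩, by simp⟩
  refine ⟨γ, e 0, e 1, ?_, hy, ?_, hspan⟩
  · rw [trZ, e₀, e₃]; linarith
  · rw [e₂, e₃]; linear_combination -hcd

theorem exists_reduced_of_class (hθ : θ ^ 2 = t * θ - 1)
    (irr : ∀ m n : ℤ, (m : 𝓞 K) * θ = n → m = 0) (ht : 2 < |t|)
    (hrank : Module.finrank ℚ K = 2) (J : (Ideal (𝓞 K))⁰) :
    ∃ γ : SL2Z, (trZ γ = t ∧ γ 0 0 * γ 1 1 ≠ 1 ∧ |γ 0 0| ≤ |t|) ∧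
      eigClass θ γ = ClassGroup.mk0 J := by
  classical
  set P : ℕ → Prop := fun n => ∃ γ : SL2Z, ∃ x y : 𝓞 K, trZ γ = t ∧ y ≠ 0 ∧
      (γ 1 0 : 𝓞 K) * x = (θ - (γ 1 1 : 𝓞 K)) * y ∧
      Ideal.span {x, y} = (J : Ideal (𝓞 K)) ∧ (γ 1 0).natAbs = n with hP
  have hex : ∃ n, P n := by
    obtain ⟨γ, x, y, h1, h2, h3, h4⟩ := exists_trZ_eq_of_class hθ irr hrank J
    exact ⟨_, γ, x, y, h1, h2, h3, h4, rfl⟩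
  obtain ⟨γ, x, y, htr, hy, hxy, hspan, hmin⟩ := Nat.find_spec hex
  have hdet := γ.det_eq
  set a := γ 0 0
  set b := γ 0 1
  set c := γ 1 0
  set d := γ 1 1
  have had : a + d = t := htr
  have hc : c ≠ 0 := by
    intro h0
    rw [h0, Int.cast_zero, zero_mul] at hxy
    exact mul_ne_zero (sub_intCast_ne_zero irr d) hy hxy.symm
  obtain ⟨k, hk⟩ := exists_abs_sub_two_mul_le (d - a) hc
  set a' := a + k * c
  set d' := d - k * c
  set b' := b - k * a + k * d - k ^ 2 * c with hb'
  have hdet' : a' * d' - b' * c = 1 := by simp only [a', d', b']; linarith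
  have hxy' : (c : 𝓞 K) * (x + k * y) = (θ - (d' : 𝓞 K)) * y := by
    simp only [d']; push_cast; linear_combination hxy
  have hspan' : Ideal.span {x + k * y, y} = (J : Ideal (𝓞 K)) := by
    rw [← hspan]
    exact Ideal.span_pair_add_mul_right x y (k : 𝓞 K)
  have hbx : (b' : 𝓞 K) * y = (θ - (a' : 𝓞 K)) * (x + k * y) := by
    have hc' : (c : 𝓞 K) ≠ 0 := by exact_mod_cast hc
    apply mul_left_cancel₀ hc'
    have h1 : ((a' * d' - b' * c : ℤ) : 𝓞 K) = 1 := by rw [hdet']; simp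
    have h2 : ((a' + d' : ℤ) : 𝓞 K) = t := by congr 1; simp only [a', d']; linarith
    push_cast at h1 h2
    linear_combination (-(θ - (a' : 𝓞 K))) * hxy' - y * h1 - y * hθ + y * θ * h2
  have hx' : x + k * y ≠ 0 := by
    intro h0
    rw [h0, mul_zero] at hxy'
    exact mul_ne_zero (sub_intCast_ne_zero irr d') hy hxy'.symm
  obtain ⟨δ, e₀, e₁, e₂, e₃⟩ : ∃ γ : SL2Z, γ 0 0 = a' ∧ γ 0 1 = b' ∧ γ 1 0 = c ∧ γ 1 1 = d' :=
    ⟨⟨!![a', b'; c, d'], by rw [Matrix.det_fin_two]; simpa using hdet'⟩, by simp⟩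
  obtain ⟨σ, s₀, s₁, s₂, s₃⟩ : ∃ γ : SL2Z, γ 0 0 = d' ∧ γ 0 1 = c ∧ γ 1 0 = b' ∧ γ 1 1 = a' :=
    ⟨⟨!![d', c; b', a'], by rw [Matrix.det_fin_two]; simp; linarith⟩, by simp⟩
  have hle : |c| ≤ |b'| := by
    have h1 : Nat.find hex ≤ b'.natAbs := by
      refine Nat.find_min' hex ⟨σ, y, x + k * y, ?_, hx', ?_, ?_, by rw [s₂]⟩
      · rw [trZ, s₀, s₃]; simp only [a', d']; linarith
      · rw [s₂, s₃]; exact hbx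
      · rw [Set.pair_comm]; exact hspan'
    rw [← hmin] at h1
    rw [Int.abs_eq_natAbs, Int.abs_eq_natAbs]
    exact_mod_cast h1
  have htr' : a' + d' = t := by simp only [a', d']; linarith
  have hda : |d' - a'| ≤ |c| := by
    have : d' - a' = d - a - 2 * k * c := by simp only [a', d']; ring
    rwa [this]
  have hb := reduced_bounds hdet' hc hle hda (by rwa [htr'])
  refine ⟨δ, ⟨?_, ?_, ?_⟩, ?_⟩
  · rw [trZ, e₀, e₃, htr']
  · rw [e₀, e₃]
    exact hb.1
  · rw [e₀, ← htr']
    exact hb.2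
  · exact (mk0_eq_eigClass irr hy (by rw [e₂, e₃]; exact hxy') hspan').symm

theorem card_classGroup_le_ncard (hθ : θ ^ 2 = t * θ - 1)
    (irr : ∀ m n : ℤ, (m : 𝓞 K) * θ = n → m = 0) (ht : 2 < |t|)
    (hrank : Module.finrank ℚ K = 2)
    (hfin : {γ : SL2Z | trZ γ = t ∧ γ 0 0 * γ 1 1 ≠ 1 ∧ |γ 0 0| ≤ |t|}.Finite) :
    Nat.card (ClassGroup (𝓞 K)) ≤
      {γ : SL2Z | trZ γ = t ∧ γ 0 0 * γ 1 1 ≠ 1 ∧ |γ 0 0| ≤ |t|}.ncard := by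
  have : Finite {γ : SL2Z | trZ γ = t ∧ γ 0 0 * γ 1 1 ≠ 1 ∧ |γ 0 0| ≤ |t|} := hfin
  refine Nat.card_le_card_of_surjective (fun γ : {γ : SL2Z | trZ γ = t ∧ γ 0 0 * γ 1 1 ≠ 1 ∧
    |γ 0 0| ≤ |t|} => eigClass θ γ.1) ?_
  intro C
  obtain ⟨J, rfl⟩ := ClassGroup.mk0_surjective C
  obtain ⟨γ, h1, h2⟩ := exists_reduced_of_class hθ irr ht hrank J
  exact ⟨⟨γ, h1⟩, h2⟩

end EigClass

theorem abs_coeff_le_of_pairs {F Q U U' Z Z' u₁ u₂ u₁' u₂' z z' Δ Δz p q : ℝ} (hF : 0 ≤ F)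
    (hQ : 0 ≤ Q) (hU : 0 ≤ U) (hU' : 0 ≤ U') (hZ : 0 ≤ Z) (hZ' : 0 ≤ Z')
    (hu₁ : |u₁| ≤ U) (hu₂ : |u₂| ≤ U) (hu₁' : |u₁'| ≤ U') (hu₂' : |u₂'| ≤ U')
    (hz : |z| ≤ Z) (hz' : |z'| ≤ Z') (hUU : U * U' ≤ |Δ| * Q) (hZZ : Z * Z' ≤ |Δz| * Q)
    (h1 : Z * U' ≤ 4 * (Z' * U)) (h2 : Z' * U ≤ 4 * (Z * U')) (hΔ : Δ = u₁ * u₂' - u₁' * u₂)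
    (hΔ0 : Δ ≠ 0) (hΔz : |Δz| ≤ F ^ 2 * |Δ|)
    (e : F * z = p * u₁ + q * u₂) (e' : F * z' = p * u₁' + q * u₂') :
    |p| ≤ 4 * Q * F ^ 2 ∧ |q| ≤ 4 * Q * F ^ 2 := by
  have hΔp : 0 < |Δ| := abs_pos.2 hΔ0
  have hprod : (Z * U') * (Z' * U) ≤ (F * Q * |Δ|) ^ 2 := by
    calc (Z * U') * (Z' * U) = (U * U') * (Z * Z') := by ring
      _ ≤ (|Δ| * Q) * (|Δz| * Q) := by gcongr
      _ ≤ (|Δ| * Q) * (F ^ 2 * |Δ| * Q) := by gcongr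
      _ = _ := by ring
  have hA : Z * U' ≤ 2 * (F * Q * |Δ|) := by
    refine (abs_le_of_sq_le_sq' ?_ (by positivity)).2
    have : (Z * U') * (Z * U') ≤ (Z * U') * (4 * (Z' * U)) := by gcongr
    nlinarith
  have hB : Z' * U ≤ 2 * (F * Q * |Δ|) := by
    refine (abs_le_of_sq_le_sq' ?_ (by positivity)).2
    have : (Z' * U) * (Z' * U) ≤ (Z' * U) * (4 * (Z * U')) := by gcongr
    nlinarith
  have key : ∀ {r v v' : ℝ}, |v| ≤ U → |v'| ≤ U' → |r| * |Δ| = F * |z * v' - z' * v| →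
      |r| ≤ 4 * Q * F ^ 2 := by
    intro r v v' hv hv' hr
    refine le_of_mul_le_mul_right ?_ hΔp
    rw [hr]
    calc F * |z * v' - z' * v| ≤ F * (|z| * |v'| + |z'| * |v|) := by
          rw [← abs_mul, ← abs_mul]; gcongr; exact abs_sub _ _
      _ ≤ F * (Z * U' + Z' * U) := by gcongr
      _ ≤ F * (2 * (F * Q * |Δ|) + 2 * (F * Q * |Δ|)) := by gcongr
      _ = _ := by ring
  constructor
  · refine key hu₂ hu₂' ?_
    rw [← abs_mul, ← abs_of_nonneg hF, ← abs_mul, hΔ]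
    congr 1
    linear_combination u₂ * e' - u₂' * e
  · refine key hu₁ hu₁' ?_
    rw [← abs_mul, ← abs_of_nonneg hF, ← abs_mul, hΔ, ← abs_neg]
    congr 1
    linear_combination u₁ * e' - u₁' * e

/-- The product of the lengths of the two eigenvectors of a matrix of small norm is controlled
by the area they span. -/
theorem eigenvector_norm_mul_sq {γ : SL2Z} {t : ℤ} (htr : trZ γ = t) (hc : γ 1 0 ≠ 0)
    {l₁ l₂ x₁ y₁ x₂ y₂ : ℝ} (hs : l₁ + l₂ = t) (hp : l₁ * l₂ = 1)
    (e₁ : (γ 1 0 : ℝ) * x₁ = (l₁ - γ 1 1) * y₁) (e₂ : (γ 1 0 : ℝ) * x₂ = (l₂ - γ 1 1) * y₂) :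
    (x₁ ^ 2 + y₁ ^ 2) * (x₂ ^ 2 + y₂ ^ 2) * ((t : ℝ) ^ 2 - 4) =
      (x₁ * y₂ - x₂ * y₁) ^ 2 * (frobNorm γ ^ 2 - 2) := by
  have hdet : (γ 0 0 : ℝ) * γ 1 1 - γ 0 1 * γ 1 0 = 1 := by exact_mod_cast γ.det_eq
  have htr' : (γ 0 0 : ℝ) + γ 1 1 = t := by exact_mod_cast htr
  rw [sq_frobNorm]
  have hc' : (γ 1 0 : ℝ) ≠ 0 := by exact_mod_cast hc
  generalize (γ 0 0 : ℝ) = a at *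
  generalize (γ 0 1 : ℝ) = b at *
  generalize (γ 1 0 : ℝ) = c at *
  generalize (γ 1 1 : ℝ) = d at *
  have hx₁ : x₁ = (l₁ - d) * y₁ / c := by field_simp; linarith
  have hx₂ : x₂ = (l₂ - d) * y₂ / c := by field_simp; linarith
  have hdisc : (t : ℝ) ^ 2 - 4 = (l₁ - l₂) ^ 2 := by rw [← hs]; linear_combination 4 * hp
  have hb : b = (a * d - 1) / c := by field_simp; linarith
  have ha : a = l₁ + l₂ - d := by linarith
  have hnorm : ((l₁ - d) ^ 2 + c ^ 2) * ((l₂ - d) ^ 2 + c ^ 2) =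
      c ^ 2 * (a ^ 2 + b ^ 2 + c ^ 2 + d ^ 2 - 2) := by
    have h1 : (l₁ - d) * (l₂ - d) = - (b * c) := by
      linear_combination hp - d * hs + d * htr' - hdet
    have h2 : (l₁ - d) ^ 2 + (l₂ - d) ^ 2 = a ^ 2 + d ^ 2 - 2 := by
      rw [ha]; linear_combination (-2) * hp
    linear_combination ((l₁ - d) * (l₂ - d) - b * c) * h1 + c ^ 2 * h2
  have hΔ : x₁ * y₂ - x₂ * y₁ = (l₁ - l₂) * (y₁ * y₂) / c := by
    rw [hx₁, hx₂]; field_simp; ring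
  rw [hΔ, hdisc, hx₁, hx₂]
  field_simp
  linear_combination (y₁ * y₂ * (l₁ - l₂)) ^ 2 * hnorm

section Fibre

variable {K : Type*} [Field K] {θ : 𝓞 K}

/-- `(x, y)` is an eigenvector of `γ` for the eigenvalue `θ` whose entries generate `J`. -/
structure IsEigenpair (θ : 𝓞 K) (γ : SL2Z) (J : Ideal (𝓞 K)) (x y : 𝓞 K) : Prop where
  ne_zero : y ≠ 0
  eig : (γ 1 0 : 𝓞 K) * x = (θ - (γ 1 1 : 𝓞 K)) * y
  span_eq : Ideal.span {x, y} = J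

theorem IsEigenpair.unit_mul {γ : SL2Z} {J : Ideal (𝓞 K)} {x y : 𝓞 K}
    (h : IsEigenpair θ γ J x y) (u : (𝓞 K)ˣ) : IsEigenpair θ γ J (u * x) (u * y) := by
  refine ⟨mul_ne_zero u.ne_zero h.ne_zero, ?_, ?_⟩
  · linear_combination (u : 𝓞 K) * h.eig
  · rw [← h.span_eq, ← one_mul (Ideal.span {x, y}), Ideal.one_eq_top,
      ← Ideal.span_singleton_eq_top.2 u.isUnit]
    simp only [Ideal.span_mul_span', Set.singleton_mul, Set.image_pair]

theorem IsEigenpair.lower_left_ne_zero (irr : ∀ m n : ℤ, (m : 𝓞 K) * θ = n → m = 0)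
    {γ : SL2Z} {J : Ideal (𝓞 K)} {x y : 𝓞 K} (h : IsEigenpair θ γ J x y) : γ 1 0 ≠ 0 := by
  intro h0
  have h1 := h.eig
  rw [h0, Int.cast_zero, zero_mul] at h1
  exact mul_ne_zero (sub_intCast_ne_zero irr _) h.ne_zero h1.symm

variable [NumberField K] {t : ℤ}

theorem exists_isEigenpair (irr : ∀ m n : ℤ, (m : 𝓞 K) * θ = n → m = 0) {γ : SL2Z}
    (hc : γ 1 0 ≠ 0) {J : (Ideal (𝓞 K))⁰} (hJ : eigClass θ γ = ClassGroup.mk0 J) :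
    ∃ x y, IsEigenpair θ γ J x y := by
  have hd := sub_intCast_ne_zero irr (γ 1 1)
  have hI : Ideal.span {θ - (γ 1 1 : 𝓞 K), (γ 1 0 : 𝓞 K)} ∈ (Ideal (𝓞 K))⁰ := by
    rw [mem_nonZeroDivisors_iff_ne_zero]
    intro h0
    rw [Ideal.zero_eq_bot, Ideal.span_eq_bot] at h0
    exact hd (h0 _ (by simp))
  rw [eigClass, dif_pos hI, ClassGroup.mk0_eq_mk0_iff] at hJ
  obtain ⟨α, β, hα, hβ, hαβ⟩ := hJ
  have hmem : ∀ z ∈ Ideal.span {θ - (γ 1 1 : 𝓞 K), (γ 1 0 : 𝓞 K)},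
      ∃ w ∈ (J : Ideal (𝓞 K)), β * w = α * z := by
    intro z hz
    have : α * z ∈ Ideal.span {α} * Ideal.span {θ - (γ 1 1 : 𝓞 K), (γ 1 0 : 𝓞 K)} :=
      Ideal.mul_mem_mul (Ideal.mem_span_singleton_self α) hz
    rw [hαβ] at this
    exact Ideal.mem_span_singleton_mul.1 this
  obtain ⟨x, -, hx⟩ := hmem _ (Ideal.subset_span (Set.mem_insert _ _))
  obtain ⟨y, -, hy⟩ := hmem _ (Ideal.subset_span (Set.mem_insert_of_mem _ rfl))
  have hc' : (γ 1 0 : 𝓞 K) ≠ 0 := by exact_mod_cast hc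
  refine ⟨x, y, ?_, ?_, ?_⟩
  · rintro rfl
    rw [mul_zero] at hy
    exact mul_ne_zero hα hc' hy.symm
  · apply mul_left_cancel₀ hβ
    linear_combination (γ 1 0 : 𝓞 K) * hx - (θ - (γ 1 1 : 𝓞 K)) * hy
  · have hβ' : Ideal.span {β} ≠ 0 := by
      rw [Ideal.zero_eq_bot, Ne, Ideal.span_singleton_eq_bot]; exact hβ
    apply mul_left_cancel₀ hβ'
    rw [← hαβ]
    simp only [Ideal.span_mul_span', Set.singleton_mul, Set.image_pair]
    rw [hx, hy]

theorem IsEigenpair.mul_fst (hθ : θ ^ 2 = t * θ - 1) {γ : SL2Z} (htr : trZ γ = t)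
    (hc : γ 1 0 ≠ 0) {J : Ideal (𝓞 K)} {x y : 𝓞 K} (h : IsEigenpair θ γ J x y) :
    θ * x = γ 0 0 * x + γ 0 1 * y := by
  have hc' : (γ 1 0 : 𝓞 K) ≠ 0 := by exact_mod_cast hc
  have h1 : ((γ 0 0 * γ 1 1 - γ 0 1 * γ 1 0 : ℤ) : 𝓞 K) = 1 := by rw [γ.det_eq]; simp
  have h2 : ((γ 0 0 + γ 1 1 : ℤ) : 𝓞 K) = t := by rw [← htr, trZ]
  push_cast at h1 h2
  apply mul_left_cancel₀ hc'
  linear_combination (θ - (γ 0 0 : 𝓞 K)) * h.eig + y * hθ - y * θ * h2 + y * h1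

theorem IsEigenpair.exists_mul_eq (hθ : θ ^ 2 = t * θ - 1) {γ : SL2Z} (htr : trZ γ = t)
    (hc : γ 1 0 ≠ 0) {F : ℕ} (hF : ∀ z : 𝓞 K, ∃ m n : ℤ, (F : 𝓞 K) * z = m + n * θ)
    {J : Ideal (𝓞 K)} {x y : 𝓞 K} (h : IsEigenpair θ γ J x y) {z : 𝓞 K} (hz : z ∈ J) :
    ∃ p q : ℤ, (F : 𝓞 K) * z = p * x + q * y := by
  rw [← h.span_eq, Ideal.mem_span_pair] at hz
  obtain ⟨α, β, rfl⟩ := hz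
  obtain ⟨m, n, hα⟩ := hF α
  obtain ⟨m', n', hβ⟩ := hF β
  have h1 := h.mul_fst hθ htr hc
  have h2 := h.eig
  refine ⟨m + n * γ 0 0 + n' * γ 1 0, m' + n * γ 0 1 + n' * γ 1 1, ?_⟩
  push_cast
  linear_combination x * hα + y * hβ + (n : 𝓞 K) * h1 - (n' : 𝓞 K) * h2

theorem IsEigenpair.ext (irr : ∀ m n : ℤ, (m : 𝓞 K) * θ = n → m = 0) {γ γ' : SL2Z}
    (htr : trZ γ = trZ γ') {J J' : Ideal (𝓞 K)} {x y : 𝓞 K} (h : IsEigenpair θ γ J x y)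
    (h' : IsEigenpair θ γ' J' x y) : γ = γ' := by
  have hc := h.lower_left_ne_zero irr
  have key : ((γ' 1 0 - γ 1 0 : ℤ) : 𝓞 K) * θ =
      ((γ' 1 0 * γ 1 1 - γ 1 0 * γ' 1 1 : ℤ) : 𝓞 K) := by
    apply mul_right_cancel₀ h.ne_zero
    push_cast
    linear_combination (γ 1 0 : 𝓞 K) * h'.eig - (γ' 1 0 : 𝓞 K) * h.eig
  obtain ⟨k1, k2⟩ := eq_zero_of_mul_eq irr key
  have hcc : γ 1 0 = γ' 1 0 := by linarith
  have hdd : γ 1 1 = γ' 1 1 := by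
    rw [← hcc, ← mul_sub] at k2
    have := (mul_eq_zero.1 k2).resolve_left hc
    linarith
  refine SL2Z.ext_of_lower_left_ne_zero hc ?_ hcc hdd
  rw [trZ, trZ] at htr
  linarith

end Fibre

section FibreBound

variable {K : Type*} [Field K] {θ : 𝓞 K} {t : ℤ}

/-- The length of the image of `(x, y)` in `ℝ²` under a real embedding. -/
def embNorm (σ : K →+* ℝ) (x y : 𝓞 K) : ℝ := √(σ x ^ 2 + σ y ^ 2)

theorem embNorm_sq (σ : K →+* ℝ) (x y : 𝓞 K) : embNorm σ x y ^ 2 = σ x ^ 2 + σ y ^ 2 :=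
  Real.sq_sqrt (by positivity)

theorem embNorm_pos (σ : K →+* ℝ) (x : 𝓞 K) {y : 𝓞 K} (hy : y ≠ 0) : 0 < embNorm σ x y := by
  have : σ y ≠ 0 := by
    rw [map_ne_zero]; exact_mod_cast hy
  exact Real.sqrt_pos.2 (by positivity)

theorem abs_le_embNorm_fst (σ : K →+* ℝ) (x y : 𝓞 K) : |σ x| ≤ embNorm σ x y := by
  refine abs_le_of_sq_le_sq ?_ (Real.sqrt_nonneg _)
  rw [embNorm_sq]; nlinarith [sq_nonneg (σ y)]

theorem abs_le_embNorm_snd (σ : K →+* ℝ) (x y : 𝓞 K) : |σ y| ≤ embNorm σ x y := by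
  refine abs_le_of_sq_le_sq ?_ (Real.sqrt_nonneg _)
  rw [embNorm_sq]; nlinarith [sq_nonneg (σ x)]

theorem embNorm_mul (σ : K →+* ℝ) (u x y : 𝓞 K) :
    embNorm σ (u * x) (u * y) = |σ u| * embNorm σ x y := by
  rw [embNorm, embNorm, ← Real.sqrt_sq_eq_abs, ← Real.sqrt_mul (sq_nonneg _)]
  congr 1
  push_cast
  simp only [map_mul]
  ring

/-- The logarithmic slope of a pair with respect to two real embeddings. -/
def logSlope (σ₁ σ₂ : K →+* ℝ) (x y : 𝓞 K) : ℝ :=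
  Real.log (embNorm σ₁ x y) - Real.log (embNorm σ₂ x y)

theorem abs_map_zpow (σ : K →+* ℝ) (u : (𝓞 K)ˣ) (k : ℤ) :
    |σ ((u ^ k : (𝓞 K)ˣ) : 𝓞 K)| = |σ (u : 𝓞 K)| ^ k := by
  have h := congrArg Units.val (map_zpow (Units.map (σ.comp (algebraMap (𝓞 K) K)).toMonoidHom) u k)
  rw [Units.val_zpow_eq_zpow_val] at h
  rw [← abs_zpow]
  congr 1

variable [NumberField K]

theorem exists_isEigenpair_logSlope_mem (hθ : θ ^ 2 = t * θ - 1)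
    (irr : ∀ m n : ℤ, (m : 𝓞 K) * θ = n → m = 0) {σ₁ σ₂ : K →+* ℝ}
    (hp : σ₁ θ * σ₂ θ = 1) (hlt : |σ₂ θ| < |σ₁ θ|) {γ : SL2Z}
    (hc : γ 1 0 ≠ 0) {J : (Ideal (𝓞 K))⁰} (hJ : eigClass θ γ = ClassGroup.mk0 J) :
    ∃ x y, IsEigenpair θ γ (J : Ideal (𝓞 K)) x y ∧ 0 ≤ logSlope σ₁ σ₂ x y ∧
      logSlope σ₁ σ₂ x y < 2 * Real.log |σ₁ θ| := by
  obtain ⟨x, y, h⟩ := exists_isEigenpair irr hc hJ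
  have h1 : 0 < |σ₁ θ| := (abs_nonneg _).trans_lt hlt
  have h2 : 0 < |σ₂ θ| := by
    rw [abs_pos]; intro h0; rw [h0, mul_zero] at hp; exact zero_ne_one hp
  have hlog : Real.log |σ₂ θ| = - Real.log |σ₁ θ| := by
    have : |σ₂ θ| = |σ₁ θ|⁻¹ := by
      refine eq_inv_of_mul_eq_one_right ?_
      rw [← abs_mul, hp, abs_one]
    rw [this, Real.log_inv]
  have hpos : 0 < 2 * Real.log |σ₁ θ| := by
    have := Real.log_lt_log h2 hlt
    rw [hlog] at this
    linarith
  let u : (𝓞 K)ˣ := Units.mkOfMulEqOne θ (t - θ) (by linear_combination -hθ)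
  obtain ⟨k, hk, -⟩ := existsUnique_add_zsmul_mem_Ico hpos (logSlope σ₁ σ₂ x y) 0
  have hslope : logSlope σ₁ σ₂ ((u ^ k : (𝓞 K)ˣ) * x) ((u ^ k : (𝓞 K)ˣ) * y) =
      logSlope σ₁ σ₂ x y + k • (2 * Real.log |σ₁ θ|) := by
    have hu : ((u : (𝓞 K)ˣ) : 𝓞 K) = θ := rfl
    rw [logSlope, embNorm_mul, embNorm_mul, abs_map_zpow, abs_map_zpow, hu,
      Real.log_mul (zpow_pos h1 k).ne' (embNorm_pos _ _ h.ne_zero).ne',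
      Real.log_mul (zpow_pos h2 k).ne' (embNorm_pos _ _ h.ne_zero).ne', Real.log_zpow,
      Real.log_zpow, hlog, logSlope, zsmul_eq_mul]
    ring
  refine ⟨_, _, h.unit_mul (u ^ k), ?_, ?_⟩
  · rw [hslope]; exact hk.1
  · rw [hslope]; simpa using hk.2

theorem IsEigenpair.embNorm_mul_le {σ₁ σ₂ : K →+* ℝ} (hs : σ₁ θ + σ₂ θ = t)
    (hp : σ₁ θ * σ₂ θ = 1) (ht : 2 < |t|) {T Q : ℝ} (hQ0 : 0 ≤ Q)
    (hQ : T ^ 2 ≤ Q ^ 2 * ((t : ℝ) ^ 2 - 4)) {γ : SL2Z} (htr : trZ γ = t) (hc : γ 1 0 ≠ 0)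
    (hT : frobNorm γ ≤ T) {J : Ideal (𝓞 K)} {x y : 𝓞 K} (h : IsEigenpair θ γ J x y) :
    embNorm σ₁ x y * embNorm σ₂ x y ≤ |σ₁ x * σ₂ y - σ₂ x * σ₁ y| * Q := by
  have e : ∀ σ : K →+* ℝ, (γ 1 0 : ℝ) * σ x = (σ θ - γ 1 1) * σ y := by
    intro σ
    have := congrArg (fun z : 𝓞 K => σ (z : K)) h.eig
    simpa using this
  have key := eigenvector_norm_mul_sq htr hc hs hp (e σ₁) (e σ₂)
  have hD : 0 < (t : ℝ) ^ 2 - 4 := by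
    have h2 : (2 : ℝ) < |(t : ℝ)| := by exact_mod_cast ht
    rw [← sq_abs]; nlinarith
  have hfrob : frobNorm γ ^ 2 - 2 ≤ Q ^ 2 * ((t : ℝ) ^ 2 - 4) := by
    have := frobNorm_nonneg γ
    nlinarith
  refine (abs_le_of_sq_le_sq' ?_ (by positivity)).2
  refine le_of_mul_le_mul_right ?_ hD
  rw [mul_pow, embNorm_sq, embNorm_sq, key, mul_pow, sq_abs]
  nlinarith [mul_le_mul_of_nonneg_left hfrob (sq_nonneg (σ₁ x * σ₂ y - σ₂ x * σ₁ y))]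

theorem IsEigenpair.det_ne_zero {σ₁ σ₂ : K →+* ℝ} (hlt : |σ₂ θ| < |σ₁ θ|) {γ : SL2Z}
    {J : Ideal (𝓞 K)} {x y : 𝓞 K} (h : IsEigenpair θ γ J x y) :
    σ₁ x * σ₂ y - σ₂ x * σ₁ y ≠ 0 := by
  have e : ∀ σ : K →+* ℝ, (γ 1 0 : ℝ) * σ x = (σ θ - γ 1 1) * σ y := by
    intro σ
    have := congrArg (fun z : 𝓞 K => σ (z : K)) h.eig
    simpa using this
  have hy : ∀ σ : K →+* ℝ, σ y ≠ 0 := by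
    intro σ
    rw [map_ne_zero]; exact_mod_cast h.ne_zero
  intro h0
  have h1 : (σ₁ θ - σ₂ θ) * (σ₁ y * σ₂ y) = 0 := by
    linear_combination (γ 1 0 : ℝ) * h0 - σ₂ y * e σ₁ + σ₁ y * e σ₂
  have h2 := (mul_eq_zero.1 h1).resolve_right (mul_ne_zero (hy _) (hy _))
  rw [sub_eq_zero] at h2
  rw [h2] at hlt
  exact lt_irrefl _ hlt

theorem mul_le_four_mul_of_log {a b c d : ℝ} (ha : 0 < a) (hb : 0 < b) (hc : 0 < c) (hd : 0 < d)
    (h : Real.log a - Real.log b ≤ Real.log c - Real.log d + 1) : a * d ≤ 4 * (b * c) := by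
  rw [← Real.log_le_log_iff (by positivity) (by positivity), Real.log_mul ha.ne' hd.ne',
    Real.log_mul (by norm_num) (by positivity), Real.log_mul hb.ne' hc.ne']
  have : 1 ≤ Real.log 4 := by
    rw [Real.le_log_iff_exp_le (by norm_num)]
    linarith [Real.exp_one_lt_d9]
  linarith

theorem IsEigenpair.exists_bounded_transition (hθ : θ ^ 2 = t * θ - 1)
    (irr : ∀ m n : ℤ, (m : 𝓞 K) * θ = n → m = 0) {σ₁ σ₂ : K →+* ℝ}
    (hs : σ₁ θ + σ₂ θ = t) (hp : σ₁ θ * σ₂ θ = 1) (hlt : |σ₂ θ| < |σ₁ θ|) (ht : 2 < |t|)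
    {F : ℕ} (hF0 : F ≠ 0) (hF : ∀ z : 𝓞 K, ∃ m n : ℤ, (F : 𝓞 K) * z = m + n * θ)
    {T Q : ℝ} (hQ0 : 0 ≤ Q) (hQ : T ^ 2 ≤ Q ^ 2 * ((t : ℝ) ^ 2 - 4))
    {γ γ' : SL2Z} (htr : trZ γ = t) (hT : frobNorm γ ≤ T) (htr' : trZ γ' = t)
    (hT' : frobNorm γ' ≤ T) {J : Ideal (𝓞 K)} {x y x' y' : 𝓞 K}
    (h : IsEigenpair θ γ J x y) (h' : IsEigenpair θ γ' J x' y')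
    (hl : |logSlope σ₁ σ₂ x y - logSlope σ₁ σ₂ x' y'| ≤ 1) :
    ∃ p q r s : ℤ, (F : 𝓞 K) * x' = p * x + q * y ∧ (F : 𝓞 K) * y' = r * x + s * y ∧
      |(p : ℝ)| ≤ 4 * Q * F ^ 2 ∧ |(q : ℝ)| ≤ 4 * Q * F ^ 2 ∧
      |(r : ℝ)| ≤ 4 * Q * F ^ 2 ∧ |(s : ℝ)| ≤ 4 * Q * F ^ 2 := by
  have hc := h.lower_left_ne_zero irr
  have hc' := h'.lower_left_ne_zero irr
  have mem : ∀ {x y : 𝓞 K} {J}, Ideal.span {x, y} = J → x ∈ J ∧ y ∈ J := by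
    rintro x y _ rfl
    exact ⟨Ideal.subset_span (Set.mem_insert _ _), Ideal.subset_span (Set.mem_insert_of_mem _ rfl)⟩
  obtain ⟨hx, hy⟩ := mem h.span_eq
  obtain ⟨hx', hy'⟩ := mem h'.span_eq
  obtain ⟨p, q, e1⟩ := h.exists_mul_eq hθ htr hc hF hx'
  obtain ⟨r, s, e2⟩ := h.exists_mul_eq hθ htr hc hF hy'
  obtain ⟨p', q', f1⟩ := h'.exists_mul_eq hθ htr' hc' hF hx
  obtain ⟨r', s', f2⟩ := h'.exists_mul_eq hθ htr' hc' hF hy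
  have emb : ∀ (σ : K →+* ℝ) {z x y : 𝓞 K} {m n : ℤ}, (F : 𝓞 K) * z = m * x + n * y →
      (F : ℝ) * σ z = m * σ x + n * σ y := by
    intro σ z x y m n h
    have := congrArg (fun z : 𝓞 K => σ (z : K)) h
    simpa using this
  have hFpos : 0 < (F : ℝ) := by positivity
  set Δ := σ₁ x * σ₂ y - σ₂ x * σ₁ y with hΔ
  set Δ' := σ₁ x' * σ₂ y' - σ₂ x' * σ₁ y' with hΔ'
  have hΔ0 : Δ ≠ 0 := h.det_ne_zero hlt
  have hΔ0' : Δ' ≠ 0 := h'.det_ne_zero hlt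
  have det1 : (F : ℝ) ^ 2 * Δ' = ((p * s - q * r : ℤ) : ℝ) * Δ := by
    push_cast
    have a1 := emb σ₁ e1
    have a2 := emb σ₂ e1
    have a3 := emb σ₁ e2
    have a4 := emb σ₂ e2
    calc (F : ℝ) ^ 2 * Δ' = (F * σ₁ x') * (F * σ₂ y') - (F * σ₂ x') * (F * σ₁ y') := by
          rw [hΔ']; ring
      _ = _ := by rw [a1, a2, a3, a4, hΔ]; ring
  have det2 : (F : ℝ) ^ 2 * Δ = ((p' * s' - q' * r' : ℤ) : ℝ) * Δ' := by
    push_cast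
    have a1 := emb σ₁ f1
    have a2 := emb σ₂ f1
    have a3 := emb σ₁ f2
    have a4 := emb σ₂ f2
    calc (F : ℝ) ^ 2 * Δ = (F * σ₁ x) * (F * σ₂ y) - (F * σ₂ x) * (F * σ₁ y) := by
          rw [hΔ]; ring
      _ = _ := by rw [a1, a2, a3, a4, hΔ']; ring
  have hΔle : |Δ'| ≤ (F : ℝ) ^ 2 * |Δ| := by
    have hne : p' * s' - q' * r' ≠ 0 := by
      intro h0
      rw [h0, Int.cast_zero, zero_mul] at det2
      exact mul_ne_zero (pow_ne_zero 2 hFpos.ne') hΔ0 det2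
    have h1 : (1 : ℝ) ≤ |((p' * s' - q' * r' : ℤ) : ℝ)| := by
      exact_mod_cast Int.one_le_abs hne
    have h2 := congrArg abs det2
    rw [abs_mul, abs_mul, abs_of_nonneg (by positivity : (0 : ℝ) ≤ (F : ℝ) ^ 2)] at h2
    rw [h2]
    exact le_mul_of_one_le_left (abs_nonneg _) h1
  have n1 := embNorm_pos σ₁ x h.ne_zero
  have n2 := embNorm_pos σ₂ x h.ne_zero
  have n1' := embNorm_pos σ₁ x' h'.ne_zero
  have n2' := embNorm_pos σ₂ x' h'.ne_zero
  have hl' := abs_le.1 hl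
  rw [logSlope, logSlope] at hl'
  have c1 : embNorm σ₁ x' y' * embNorm σ₂ x y ≤ 4 * (embNorm σ₂ x' y' * embNorm σ₁ x y) :=
    mul_le_four_mul_of_log n1' n2' n1 n2 (by linarith)
  have c2 : embNorm σ₂ x' y' * embNorm σ₁ x y ≤ 4 * (embNorm σ₁ x' y' * embNorm σ₂ x y) :=
    mul_le_four_mul_of_log n2' n1' n2 n1 (by linarith)
  have UU := h.embNorm_mul_le hs hp ht hQ0 hQ htr hc hT
  have ZZ := h'.embNorm_mul_le hs hp ht hQ0 hQ htr' hc' hT'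
  have b1 := abs_coeff_le_of_pairs hFpos.le hQ0 n1.le n2.le n1'.le n2'.le
    (abs_le_embNorm_fst σ₁ x y) (abs_le_embNorm_snd σ₁ x y) (abs_le_embNorm_fst σ₂ x y)
    (abs_le_embNorm_snd σ₂ x y) (abs_le_embNorm_fst σ₁ x' y') (abs_le_embNorm_fst σ₂ x' y')
    UU ZZ c1 c2 hΔ hΔ0 hΔle (emb σ₁ e1) (emb σ₂ e1)
  have b2 := abs_coeff_le_of_pairs hFpos.le hQ0 n1.le n2.le n1'.le n2'.le
    (abs_le_embNorm_fst σ₁ x y) (abs_le_embNorm_snd σ₁ x y) (abs_le_embNorm_fst σ₂ x y)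
    (abs_le_embNorm_snd σ₂ x y) (abs_le_embNorm_snd σ₁ x' y') (abs_le_embNorm_snd σ₂ x' y')
    UU ZZ c1 c2 hΔ hΔ0 hΔle (emb σ₁ e2) (emb σ₂ e2)
  exact ⟨p, q, r, s, e1, e2, b1.1, b1.2, b2.1, b2.2⟩

theorem abs_int_le_floor {p : ℤ} {B : ℝ} (h : |(p : ℝ)| ≤ B) : |p| ≤ (⌊B⌋₊ : ℤ) := by
  have h1 : ((p.natAbs : ℕ) : ℝ) ≤ B := by rwa [Nat.cast_natAbs, Int.cast_abs]
  have := Nat.le_floor h1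
  rw [Int.abs_eq_natAbs]
  exact_mod_cast this

/-- There are few matrices of trace `t` and small norm in terms of the class number. -/
theorem ncard_trZ_eq_frobNorm_le (hθ : θ ^ 2 = t * θ - 1)
    (irr : ∀ m n : ℤ, (m : 𝓞 K) * θ = n → m = 0) {σ₁ σ₂ : K →+* ℝ}
    (hs : σ₁ θ + σ₂ θ = t) (hp : σ₁ θ * σ₂ θ = 1) (hlt : |σ₂ θ| < |σ₁ θ|) (ht : 2 < |t|)
    {F : ℕ} (hF0 : F ≠ 0) (hF : ∀ z : 𝓞 K, ∃ m n : ℤ, (F : 𝓞 K) * z = m + n * θ)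
    {T Q : ℝ} (hQ0 : 0 ≤ Q) (hQ : T ^ 2 ≤ Q ^ 2 * ((t : ℝ) ^ 2 - 4)) :
    {γ : SL2Z | trZ γ = t ∧ frobNorm γ ≤ T}.ncard ≤ (2 * ⌊4 * Q * (F : ℝ) ^ 2⌋₊ + 1) ^ 4 *
      (Nat.card (ClassGroup (𝓞 K)) * (⌊2 * Real.log |σ₁ θ|⌋₊ + 1)) := by
  classical
  set S := {γ : SL2Z | trZ γ = t ∧ frobNorm γ ≤ T} with hS
  have hfin : S.Finite := (finite_frobNorm_le T).subset fun γ h => h.2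
  set H := ⌊4 * Q * (F : ℝ) ^ 2⌋₊
  set L := ⌊2 * Real.log |σ₁ θ|⌋₊
  have hex : ∀ γ : SL2Z, ∃ w : 𝓞 K × 𝓞 K, γ ∈ S →
      IsEigenpair θ γ ((Classical.choose (ClassGroup.mk0_surjective (eigClass θ γ)) :
        (Ideal (𝓞 K))⁰) : Ideal (𝓞 K)) w.1 w.2 ∧ 0 ≤ logSlope σ₁ σ₂ w.1 w.2 ∧
      logSlope σ₁ σ₂ w.1 w.2 < 2 * Real.log |σ₁ θ| := by
    intro γ
    by_cases hγ : γ ∈ S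
    · have hc : γ 1 0 ≠ 0 := by
        intro h0
        have hdet := γ.det_eq
        rw [h0, mul_zero, sub_zero] at hdet
        have htr : γ 0 0 + γ 1 1 = t := hγ.1
        rcases Int.eq_one_or_neg_one_of_mul_eq_one' hdet with h | h
        · rw [h.1, h.2] at htr; rw [← htr] at ht; norm_num at ht
        · rw [h.1, h.2] at htr; rw [← htr] at ht; norm_num at ht
      obtain ⟨x, y, h⟩ := exists_isEigenpair_logSlope_mem hθ irr hp hlt hc
        (Classical.choose_spec (ClassGroup.mk0_surjective (eigClass θ γ))).symm
      exact ⟨(x, y), fun _ => h⟩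
    · exact ⟨0, fun h => absurd h hγ⟩
  choose w hw using hex
  have hcard := Finset.card_le_mul_card_image_of_maps_to (s := hfin.toFinset)
    (t := (Finset.univ : Finset (ClassGroup (𝓞 K))) ×ˢ Finset.range (L + 1))
    (f := fun γ => (eigClass θ γ, ⌊logSlope σ₁ σ₂ (w γ).1 (w γ).2⌋₊)) ?_ ((2 * H + 1) ^ 4) ?_
  · rw [Set.ncard_eq_toFinset_card _ hfin]
    simpa [Nat.card_eq_fintype_card] using hcard
  · intro γ hγ
    have h := hw γ (hfin.mem_toFinset.1 hγ)
    simp only [Finset.mem_product, Finset.mem_univ, true_and, Finset.mem_range]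
    exact Nat.lt_succ_of_le (Nat.floor_le_floor h.2.2.le)
  · rintro ⟨C, k⟩ -
    rcases Finset.eq_empty_or_nonempty (hfin.toFinset.filter fun γ =>
      (eigClass θ γ, ⌊logSlope σ₁ σ₂ (w γ).1 (w γ).2⌋₊) = (C, k)) with h0 | ⟨γ₀, hγ₀⟩
    · rw [h0]; simp
    simp only [Finset.mem_filter, Set.Finite.mem_toFinset, Prod.mk.injEq] at hγ₀
    obtain ⟨hS₀, hC₀, hk₀⟩ := hγ₀
    have h₀ := hw γ₀ hS₀
    have htrans : ∀ γ : SL2Z, ∃ m : ℤ × ℤ × ℤ × ℤ,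
        (γ ∈ S ∧ eigClass θ γ = C ∧ ⌊logSlope σ₁ σ₂ (w γ).1 (w γ).2⌋₊ = k) →
        (F : 𝓞 K) * (w γ).1 = m.1 * (w γ₀).1 + m.2.1 * (w γ₀).2 ∧
        (F : 𝓞 K) * (w γ).2 = m.2.2.1 * (w γ₀).1 + m.2.2.2 * (w γ₀).2 ∧
        |m.1| ≤ H ∧ |m.2.1| ≤ H ∧ |m.2.2.1| ≤ H ∧ |m.2.2.2| ≤ H := by
      intro γ
      by_cases hγ : γ ∈ S ∧ eigClass θ γ = C ∧ ⌊logSlope σ₁ σ₂ (w γ).1 (w γ).2⌋₊ = k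
      · have h := hw γ hγ.1
        have hl : |logSlope σ₁ σ₂ (w γ₀).1 (w γ₀).2 - logSlope σ₁ σ₂ (w γ).1 (w γ).2| ≤ 1 := by
          have a1 := Nat.floor_le h.2.1
          have a2 := Nat.lt_floor_add_one (logSlope σ₁ σ₂ (w γ).1 (w γ).2)
          have b1 := Nat.floor_le h₀.2.1
          have b2 := Nat.lt_floor_add_one (logSlope σ₁ σ₂ (w γ₀).1 (w γ₀).2)
          rw [hγ.2.2] at a1 a2
          rw [hk₀] at b1 b2
          rw [abs_le]
          constructor <;> linarith
        have h1 := h.1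
        have h2 := h₀.1
        rw [hγ.2.1] at h1
        rw [hC₀] at h2
        obtain ⟨p, q, r, s, e1, e2, b1, b2, b3, b4⟩ := h2.exists_bounded_transition hθ irr hs hp
          hlt ht hF0 hF hQ0 hQ hS₀.1 hS₀.2 hγ.1.1 hγ.1.2 h1 hl
        exact ⟨(p, q, r, s), fun _ => ⟨e1, e2, abs_int_le_floor b1, abs_int_le_floor b2,
          abs_int_le_floor b3, abs_int_le_floor b4⟩⟩
      · exact ⟨0, fun h => absurd h hγ⟩
    choose m hm using htrans
    set I := Finset.Icc (-(H : ℤ)) H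
    refine (Finset.card_le_card_of_injOn (t := I ×ˢ I ×ˢ I ×ˢ I) m ?_ ?_).trans_eq ?_
    · intro γ hγ
      simp only [Finset.coe_filter, Set.Finite.mem_toFinset, Prod.mk.injEq,
        Set.mem_ofPred_eq] at hγ
      obtain ⟨-, -, b1, b2, b3, b4⟩ := hm γ hγ
      simp only [Finset.coe_product, Set.mem_prod, Finset.mem_coe, I, Finset.mem_Icc]
      exact ⟨abs_le.1 b1, abs_le.1 b2, abs_le.1 b3, abs_le.1 b4⟩
    · intro γ hγ γ' hγ' hmm
      simp only [Finset.coe_filter, Set.Finite.mem_toFinset, Prod.mk.injEq,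
        Set.mem_ofPred_eq] at hγ hγ'
      obtain ⟨e1, e2, -⟩ := hm γ hγ
      obtain ⟨e1', e2', -⟩ := hm γ' hγ'
      have hFne : (F : 𝓞 K) ≠ 0 := by exact_mod_cast hF0
      rw [hmm] at e1 e2
      have w1 : (w γ).1 = (w γ').1 := mul_left_cancel₀ hFne (e1.trans e1'.symm)
      have w2 : (w γ).2 = (w γ').2 := mul_left_cancel₀ hFne (e2.trans e2'.symm)
      have h1 := (hw γ hγ.1).1
      have h2 := (hw γ' hγ'.1).1
      rw [← w1, ← w2] at h2
      exact h1.ext irr (hγ.1.1.trans hγ'.1.1.symm) h2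
    · simp only [Finset.card_product, I, Int.card_Icc]
      have : ((H : ℤ) + 1 - -(H : ℤ)).toNat = 2 * H + 1 := by omega
      rw [this]
      ring

end FibreBound

section RealQuadratic

theorem not_isSquare_sq_sub_four {t : ℤ} (ht : 2 < |t|) : ¬ IsSquare (t ^ 2 - 4) := by
  rintro ⟨s, hs⟩
  rw [← abs_mul_abs_self s, ← sq_abs t] at hs
  have h0 := abs_nonneg s
  rcases lt_or_ge |s| |t| with h | h
  · have : |s| ≤ |t| - 1 := by omega
    nlinarith
  · nlinarith

theorem exists_quadratic_data {t : ℤ} (ht : 2 < |t|) {K : IntermediateField ℚ ℝ}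
    (hK : K = IntermediateField.adjoin ℚ {√((t : ℝ) ^ 2 - 4)}) :
    NumberField K ∧ Module.finrank ℚ K = 2 ∧ ∃ (θ : 𝓞 K) (σ₁ σ₂ : K →+* ℝ),
      θ ^ 2 = t * θ - 1 ∧ σ₁ θ + σ₂ θ = t ∧ σ₁ θ * σ₂ θ = 1 ∧ |σ₂ θ| < |σ₁ θ| ∧
      ∀ x : K, ∃ p q : ℚ, x = p + q * θ := by
  subst hK
  set d : ℝ := √((t : ℝ) ^ 2 - 4) with hd
  have hD : 0 < (t : ℝ) ^ 2 - 4 := by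
    have h2 : (2 : ℝ) < |(t : ℝ)| := by exact_mod_cast ht
    rw [← sq_abs]; nlinarith
  have hd2 : d ^ 2 = (t : ℝ) ^ 2 - 4 := Real.sq_sqrt hD.le
  have hdpos : 0 < d := Real.sqrt_pos.2 hD
  set f : Polynomial ℚ := Polynomial.X ^ 2 - Polynomial.C ((t : ℚ) ^ 2 - 4) with hf
  have hmonic : f.Monic := Polynomial.monic_X_pow_sub_C _ two_ne_zero
  have hdeg : f.natDegree = 2 := Polynomial.natDegree_X_pow_sub_C
  have hirr : Irreducible f := by
    rw [hf, X_pow_sub_C_irreducible_iff_of_prime Nat.prime_two]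
    intro b hb
    apply not_isSquare_sq_sub_four ht
    rw [← Rat.isSquare_intCast_iff]
    exact ⟨b, by push_cast; rw [← hb]; ring⟩
  have haev : ∀ e : ℝ, e ^ 2 = (t : ℝ) ^ 2 - 4 → Polynomial.aeval e f = 0 := by
    intro e he
    simp [hf, he]
  have hmin : minpoly ℚ d = f := (minpoly.eq_of_irreducible_of_monic hirr (haev d hd2) hmonic).symm
  have hint : IsIntegral ℚ d := ⟨f, hmonic, by simpa [Polynomial.aeval_def] using haev d hd2⟩
  let pb := IntermediateField.adjoin.powerBasis hint
  have hdim : pb.dim = 2 := by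
    rw [IntermediateField.adjoin.powerBasis_dim, hmin, hdeg]
  have hfd : FiniteDimensional ℚ (IntermediateField.adjoin ℚ {d}) := pb.finite
  have hnf : NumberField (IntermediateField.adjoin ℚ {d}) := ⟨⟩
  refine ⟨hnf, by rw [pb.finrank, hdim], ?_⟩
  have hmin' := (IntermediateField.minpoly_gen ℚ d).trans hmin
  let τ : IntermediateField.adjoin ℚ {d} →ₐ[ℚ] ℝ := pb.lift (-d)
    ((congrArg (Polynomial.aeval (-d)) hmin').trans (haev _ (by rw [neg_sq, hd2])))
  have hτ : τ pb.gen = -d := pb.lift_gen _ _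
  let ι : IntermediateField.adjoin ℚ {d} →ₐ[ℚ] ℝ := (IntermediateField.adjoin ℚ {d}).val
  have hι : ι pb.gen = d := rfl
  have hg2 : pb.gen ^ 2 = (t : IntermediateField.adjoin ℚ {d}) ^ 2 - 4 := by
    apply ι.toRingHom.injective
    change pb.gen.1 ^ 2 = _
    exact hd2
  let z : IntermediateField.adjoin ℚ {d} := (t + pb.gen) / 2
  have hz : z ^ 2 = t * z - 1 := by
    simp only [z]; field_simp; linear_combination hg2
  have hzint : IsIntegral ℤ z := by
    refine ⟨Polynomial.X ^ 2 - (Polynomial.C t * Polynomial.X - 1), ?_, ?_⟩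
    · monicity!
    · simp only [Polynomial.eval₂_sub, Polynomial.eval₂_mul, Polynomial.eval₂_C, Polynomial.eval₂_X,
        Polynomial.eval₂_X_pow, Polynomial.eval₂_one, hz]
      simp
  let θ : 𝓞 (IntermediateField.adjoin ℚ {d}) := ⟨z, hzint⟩
  have hθz : (θ : IntermediateField.adjoin ℚ {d}) = z := rfl
  have hιθ : ι θ = (t + d) / 2 := by
    rw [hθz]; simp only [z, map_div₀, map_add, hι, map_intCast, map_ofNat]
  have hτθ : τ θ = (t - d) / 2 := by
    rw [hθz]; simp only [z, map_div₀, map_add, hτ, map_intCast, map_ofNat]; ring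
  have hθ : θ ^ 2 = t * θ - 1 := by
    apply NumberField.RingOfIntegers.ext
    push_cast
    exact hz
  have hbasis : ∀ x : IntermediateField.adjoin ℚ {d}, ∃ p q : ℚ, x = p + q * θ := by
    intro x
    obtain ⟨g, hg, rfl⟩ := pb.exists_eq_aeval x
    rw [hdim] at hg
    obtain ⟨a, b, rfl⟩ := Polynomial.exists_eq_X_add_C_of_natDegree_le_one (Nat.le_of_lt_succ hg)
    refine ⟨b - a * t, 2 * a, ?_⟩
    rw [hθz]
    simp only [z, map_add, map_mul, Polynomial.aeval_C, Polynomial.aeval_X, eq_ratCast]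
    push_cast
    ring
  have hs : ι θ + τ θ = t := by rw [hιθ, hτθ]; ring
  have hp : ι θ * τ θ = 1 := by rw [hιθ, hτθ]; linear_combination -hd2 / 4
  rcases lt_trichotomy t 0 with h | rfl | h
  · have h' : (t : ℝ) < 0 := by exact_mod_cast h
    refine ⟨θ, τ, ι, hθ, (add_comm _ _).trans hs, (mul_comm _ _).trans hp, ?_, hbasis⟩
    change |ι θ| < |τ θ|
    rw [hιθ, hτθ, ← sq_lt_sq]
    nlinarith
  · norm_num at ht
  · have h' : (0 : ℝ) < t := by exact_mod_cast h
    refine ⟨θ, ι, τ, hθ, hs, hp, ?_, hbasis⟩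
    change |τ θ| < |ι θ|
    rw [hιθ, hτθ, ← sq_lt_sq]
    nlinarith

theorem Rat.exists_int_eq_of_sq_mul_squarefree {y : ℚ} {u : ℕ} (hu : Squarefree u) {n : ℤ}
    (h : y ^ 2 * u = n) : ∃ k : ℤ, y = k := by
  have hden : (y.den : ℚ) ≠ 0 := by exact_mod_cast y.den_nz
  have h1 : (y.num : ℚ) ^ 2 * u = n * (y.den : ℚ) ^ 2 := by
    rw [← h]
    nth_rewrite 2 [← Rat.num_div_den y]
    field_simp
  have h2 : y.num ^ 2 * (u : ℤ) = n * (y.den : ℤ) ^ 2 := by exact_mod_cast h1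
  have h3 : y.den ^ 2 ∣ u := by
    have hcop : Nat.Coprime (y.den ^ 2) (y.num.natAbs ^ 2) :=
      Nat.Coprime.pow 2 2 y.reduced.symm
    refine hcop.dvd_of_dvd_mul_left ?_
    have := congrArg Int.natAbs h2
    simp only [Int.natAbs_mul, Int.natAbs_pow, Int.natAbs_natCast] at this
    exact ⟨n.natAbs, by rw [this, mul_comm]⟩
  have h4 : y.den = 1 := Nat.isUnit_iff.1 (hu _ (by rwa [sq] at h3))
  exact ⟨y.num, (Rat.den_eq_one_iff y).1 h4 |>.symm⟩

theorem exists_int_eq_four_mul {t : ℤ} {r₁ s₁ r₂ s₂ : ℕ} (h₁ : (t - 2).natAbs = r₁ ^ 2 * s₁)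
    (h₂ : (t + 2).natAbs = r₂ ^ 2 * s₂) (hs₁ : Squarefree s₁) (hs₂ : Squarefree s₂) {q : ℚ}
    {n : ℤ} (h : q ^ 2 * ((t : ℚ) ^ 2 - 4) = n) : ∃ k : ℤ, 4 * r₁ * r₂ * q = k := by
  obtain ⟨u₁, hu₁⟩ := Nat.gcd_dvd_left s₁ s₂
  obtain ⟨u₂, hu₂⟩ := Nat.gcd_dvd_right s₁ s₂
  have hg0 : 0 < Nat.gcd s₁ s₂ := Nat.gcd_pos_of_pos_left _ (Nat.pos_of_ne_zero hs₁.ne_zero)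
  have hcop : Nat.Coprime u₁ u₂ := by
    have := Nat.coprime_div_gcd_div_gcd hg0
    rwa [Nat.div_eq_of_eq_mul_right hg0 hu₁, Nat.div_eq_of_eq_mul_right hg0 hu₂] at this
  set g := Nat.gcd s₁ s₂
  have hu : Squarefree (u₁ * u₂) := by
    rw [Nat.squarefree_mul hcop]
    exact ⟨hs₁.squarefree_of_dvd ⟨g, by rw [hu₁, mul_comm]⟩,
      hs₂.squarefree_of_dvd ⟨g, by rw [hu₂, mul_comm]⟩⟩
  have hg : (g : ℤ) ∣ 4 := by
    have d₁ : (g : ℤ) ∣ t - 2 := Int.natCast_dvd.2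
      (h₁ ▸ (Nat.gcd_dvd_left s₁ s₂).trans (Dvd.intro_left _ rfl))
    have d₂ : (g : ℤ) ∣ t + 2 := Int.natCast_dvd.2
      (h₂ ▸ (Nat.gcd_dvd_right s₁ s₂).trans (Dvd.intro_left _ rfl))
    have := dvd_sub d₂ d₁
    rwa [show t + 2 - (t - 2) = 4 by ring] at this
  obtain ⟨e, he⟩ := hg
  have habs : |(t : ℚ) ^ 2 - 4| = (r₁ : ℚ) ^ 2 * s₁ * ((r₂ : ℚ) ^ 2 * s₂) := by
    have a₁ : |(t : ℚ) - 2| = (r₁ : ℚ) ^ 2 * s₁ := by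
      have := congrArg (Nat.cast : ℕ → ℚ) h₁
      rw [Nat.cast_natAbs] at this
      push_cast at this
      exact this
    have a₂ : |(t : ℚ) + 2| = (r₂ : ℚ) ^ 2 * s₂ := by
      have := congrArg (Nat.cast : ℕ → ℚ) h₂
      rw [Nat.cast_natAbs] at this
      push_cast at this
      exact this
    rw [← a₁, ← a₂, ← abs_mul]
    congr 1
    ring
  have hy : (q * r₁ * r₂ * g) ^ 2 * ((u₁ * u₂ : ℕ) : ℚ) = (|n| : ℤ) := by
    have e₁ : (s₁ : ℚ) = g * u₁ := by exact_mod_cast hu₁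
    have e₂ : (s₂ : ℚ) = g * u₂ := by exact_mod_cast hu₂
    rw [Int.cast_abs, ← h, abs_mul, abs_of_nonneg (sq_nonneg q), habs, e₁, e₂]
    push_cast
    ring
  obtain ⟨k, hk⟩ := Rat.exists_int_eq_of_sq_mul_squarefree hu hy
  refine ⟨k * e, ?_⟩
  have he' : (4 : ℚ) = g * e := by exact_mod_cast he
  push_cast
  rw [← hk, he']
  ring

theorem exists_int_eq_of_isIntegral {x : ℚ} (h : IsIntegral ℤ (x : ℝ)) : ∃ n : ℤ, x = n := by
  have h1 : IsIntegral ℤ x := (isIntegral_algebraMap_iff (algebraMap ℚ ℝ).injective).1 h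
  obtain ⟨n, hn⟩ := IsIntegrallyClosed.isIntegral_iff.1 h1
  exact ⟨n, hn.symm⟩

/-- The index of `ℤ[θ]` is controlled by the square parts of `t - 2` and `t + 2`. -/
theorem exists_mul_eq_add_mul {K : Type*} [Field K] [NumberField K] {t : ℤ} {θ : 𝓞 K}
    {σ₁ σ₂ : K →+* ℝ} (hs : σ₁ θ + σ₂ θ = t) (hp : σ₁ θ * σ₂ θ = 1)
    (hb : ∀ x : K, ∃ p q : ℚ, x = p + q * θ) {r₁ s₁ r₂ s₂ : ℕ}
    (h₁ : (t - 2).natAbs = r₁ ^ 2 * s₁) (h₂ : (t + 2).natAbs = r₂ ^ 2 * s₂)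
    (hs₁ : Squarefree s₁) (hs₂ : Squarefree s₂) (z : 𝓞 K) :
    ∃ m n : ℤ, ((8 * r₁ * r₂ : ℕ) : 𝓞 K) * z = m + n * θ := by
  obtain ⟨p, q, hz⟩ := hb z
  have hσ : ∀ σ : K →+* ℝ, σ z = p + q * σ θ := by
    intro σ
    rw [hz, map_add, map_mul, map_ratCast, map_ratCast]
  have hi : ∀ σ : K →+* ℝ, IsIntegral ℤ (σ z) := fun σ =>
    (NumberField.RingOfIntegers.isIntegral_coe z).map σ.toIntAlgHom
  obtain ⟨U, hU⟩ := exists_int_eq_of_isIntegral (x := 2 * p + q * t) (by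
    have := (hi σ₁).add (hi σ₂)
    rw [hσ, hσ] at this
    have e : ((2 * p + q * t : ℚ) : ℝ) = p + q * σ₁ θ + (p + q * σ₂ θ) := by
      push_cast
      linear_combination -(q : ℝ) * hs
    rwa [e])
  obtain ⟨V, hV⟩ := exists_int_eq_of_isIntegral (x := p ^ 2 + p * q * t + q ^ 2) (by
    have := (hi σ₁).mul (hi σ₂)
    rw [hσ, hσ] at this
    have e : ((p ^ 2 + p * q * t + q ^ 2 : ℚ) : ℝ) = (p + q * σ₁ θ) * (p + q * σ₂ θ) := by
      push_cast
      linear_combination -(p * q : ℝ) * hs - (q : ℝ) ^ 2 * hp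
    rwa [e])
  obtain ⟨k, hk⟩ := exists_int_eq_four_mul h₁ h₂ hs₁ hs₂ (q := q) (n := U ^ 2 - 4 * V) (by
    push_cast
    rw [← hU, ← hV]
    ring)
  refine ⟨4 * r₁ * r₂ * U - k * t, 2 * k, ?_⟩
  apply NumberField.RingOfIntegers.ext
  have hU' : (2 * p + q * t : K) = U := by exact_mod_cast congrArg (Rat.cast : ℚ → K) hU
  have hk' : (4 * r₁ * r₂ * q : K) = k := by exact_mod_cast congrArg (Rat.cast : ℚ → K) hk
  have h : (((8 * r₁ * r₂ : ℕ) : K) * z : K) =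
      ((4 * r₁ * r₂ * U - k * t : ℤ) : K) + ((2 * k : ℤ) : K) * θ := by
    push_cast
    rw [hz, ← hU', ← hk']
    ring
  change algebraMap (𝓞 K) K _ = algebraMap (𝓞 K) K _
  rw [map_mul, map_natCast, map_add, map_mul, map_intCast, map_intCast]
  exact h

theorem eq_zero_of_mul_eq_intCast {K : Type*} [Field K] [NumberField K] {θ : 𝓞 K} {σ₁ σ₂ : K →+* ℝ}
    (hlt : |σ₂ θ| < |σ₁ θ|) (m n : ℤ) (h : (m : 𝓞 K) * θ = n) : m = 0 := by
  have e : ∀ σ : K →+* ℝ, (m : ℝ) * σ θ = n := by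
    intro σ
    have := congrArg (fun z : 𝓞 K => σ (z : K)) h
    simpa using this
  by_contra hm
  have hm' : (m : ℝ) ≠ 0 := by exact_mod_cast hm
  have := mul_left_cancel₀ hm' ((e σ₁).trans (e σ₂).symm)
  rw [this] at hlt
  exact lt_irrefl _ hlt

end RealQuadratic

/-- The class number of `ℚ(√(t² - 4))`. -/
def quadClassNumber (t : ℤ) : ℕ :=
  Nat.card (ClassGroup (𝓞 ↥(IntermediateField.adjoin ℚ {√((t : ℝ) ^ 2 - 4)})))

theorem quadClassNumber_pos {t : ℤ} (ht : 2 < |t|) : 0 < quadClassNumber t := by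
  have := (exists_quadratic_data ht rfl).1
  exact Nat.card_pos

theorem quadClassNumber_le {t : ℤ} (ht : 2 < |t|) {ε C : ℝ} (hε : 0 ≤ ε) (hC1 : 1 ≤ C)
    (hC : ∀ n : ℕ, n ≠ 0 → (n.divisors.card : ℝ) ≤ C * (n : ℝ) ^ ε) :
    (quadClassNumber t : ℝ) ≤
      (2 * t.natAbs + 1) * (2 * (C * (4 * (t.natAbs : ℝ) ^ 2) ^ ε)) := by
  obtain ⟨hnf, hrank, θ, σ₁, σ₂, hθ, hs, hp, hlt, -⟩ := exists_quadratic_data ht rfl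
  have h := ncard_trZ_eq_le hε hC hC1 (N := t.natAbs) (t := t) 
    (by rw [Int.abs_eq_natAbs] at ht; omega) (by rw [Int.abs_eq_natAbs]; omega)
  rw [← Int.abs_eq_natAbs] at h
  have irr := eq_zero_of_mul_eq_intCast hlt
  refine le_trans ?_ h.2
  exact_mod_cast card_classGroup_le_ncard hθ irr ht hrank h.1

theorem ncard_trZ_eq_frobNorm_le_of_square_parts {t : ℤ} (ht : 2 < |t|) {r₁ s₁ r₂ s₂ : ℕ}
    (h₁ : (t - 2).natAbs = r₁ ^ 2 * s₁) (h₂ : (t + 2).natAbs = r₂ ^ 2 * s₂)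
    (hs₁ : Squarefree s₁) (hs₂ : Squarefree s₂) {R : ℝ} (hr₁ : r₁ ≤ R) (hr₂ : r₂ ≤ R)
    {T Q : ℝ} (hQ0 : 0 ≤ Q) (hQ : T ^ 2 ≤ Q ^ 2 * ((t : ℝ) ^ 2 - 4)) :
    ({γ : SL2Z | trZ γ = t ∧ frobNorm γ ≤ T}.ncard : ℝ) ≤
      (512 * Q * R ^ 4 + 1) ^ 4 * (quadClassNumber t * (2 * Real.log (|t| + 1) + 1)) := by
  obtain ⟨hnf, hrank, θ, σ₁, σ₂, hθ, hs, hp, hlt, hb⟩ := exists_quadratic_data ht rfl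
  have irr := eq_zero_of_mul_eq_intCast hlt
  have hr₁0 : r₁ ≠ 0 := by
    rintro rfl
    rw [zero_pow two_ne_zero, zero_mul, Int.natAbs_eq_zero] at h₁
    rw [show t = 2 by omega] at ht
    norm_num at ht
  have hr₂0 : r₂ ≠ 0 := by
    rintro rfl
    rw [zero_pow two_ne_zero, zero_mul, Int.natAbs_eq_zero] at h₂
    rw [show t = -2 by omega] at ht
    norm_num at ht
  have hR0 : 0 ≤ R := le_trans (Nat.cast_nonneg _) hr₁
  have h := ncard_trZ_eq_frobNorm_le hθ irr hs hp hlt ht (F := 8 * r₁ * r₂) (by positivity)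
    (exists_mul_eq_add_mul hs hp hb h₁ h₂ hs₁ hs₂) hQ0 hQ
  have hσ2 : |σ₂ θ| < 1 := by
    by_contra! h1
    have h2 : |σ₁ θ| * |σ₂ θ| = 1 := by rw [← abs_mul, hp, abs_one]
    nlinarith
  have hσ1 : 1 < |σ₁ θ| := by
    have h2 : |σ₁ θ| * |σ₂ θ| = 1 := by rw [← abs_mul, hp, abs_one]
    by_contra! h1
    nlinarith [abs_nonneg (σ₁ θ), abs_nonneg (σ₂ θ)]
  have hσ : |σ₁ θ| ≤ |(t : ℝ)| + 1 := by
    have := abs_sub (σ₁ θ + σ₂ θ) (σ₂ θ)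
    rw [add_sub_cancel_right, hs] at this
    linarith
  have hlog0 : 0 ≤ Real.log |σ₁ θ| := Real.log_nonneg hσ1.le
  have hlog : Real.log |σ₁ θ| ≤ Real.log (|t| + 1) := by
    push_cast
    exact Real.log_le_log (by linarith) hσ
  have hfl : (⌊4 * Q * ((8 * r₁ * r₂ : ℕ) : ℝ) ^ 2⌋₊ : ℝ) ≤ 256 * Q * R ^ 4 := by
    refine (Nat.floor_le (by positivity)).trans ?_
    have h3 : (r₁ : ℝ) * r₂ ≤ R * R := by gcongr
    have h4 : ((r₁ : ℝ) * r₂) ^ 2 ≤ (R * R) ^ 2 := by gcongr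
    push_cast
    calc 4 * Q * (8 * r₁ * r₂ : ℝ) ^ 2 = 256 * Q * ((r₁ : ℝ) * r₂) ^ 2 := by ring
      _ ≤ 256 * Q * (R * R) ^ 2 := by gcongr
      _ = _ := by ring
  have hfl2 : (⌊2 * Real.log |σ₁ θ|⌋₊ : ℝ) ≤ 2 * Real.log (|t| + 1) :=
    (Nat.floor_le (by positivity)).trans (by linarith)
  calc ({γ : SL2Z | trZ γ = t ∧ frobNorm γ ≤ T}.ncard : ℝ)
      ≤ (2 * ⌊4 * Q * ((8 * r₁ * r₂ : ℕ) : ℝ) ^ 2⌋₊ + 1) ^ 4 *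
      (quadClassNumber t * (⌊2 * Real.log |σ₁ θ|⌋₊ + 1)) := by exact_mod_cast h
    _ ≤ (2 * (256 * Q * R ^ 4) + 1) ^ 4 *
      (quadClassNumber t * (2 * Real.log (|t| + 1) + 1)) := by gcongr
    _ = _ := by ring

open Classical in
/-- The nonzero integers of absolute value at most `M` with a square divisor `r²`, `r > k`. -/
def squareDivisible (M k : ℕ) : Finset ℤ :=
  {m ∈ Finset.Icc (-(M : ℤ)) M | m ≠ 0 ∧ ∃ r : ℕ, k < r ∧ r ^ 2 ∣ m.natAbs}

theorem mem_squareDivisible {M k : ℕ} {m : ℤ} : m ∈ squareDivisible M k ↔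
    |m| ≤ M ∧ m ≠ 0 ∧ ∃ r : ℕ, k < r ∧ r ^ 2 ∣ m.natAbs := by
  classical
  rw [squareDivisible, Finset.mem_filter, Finset.mem_Icc, abs_le]

theorem card_squareDivisible_le {M k : ℕ} (hk : k ≠ 0) :
    ((squareDivisible M k).card : ℝ) ≤ 2 * M / k := by
  classical
  set A : Finset ℕ :=
    (Finset.Ioc k M).biUnion fun r => (Finset.Ioc 0 M).filter (r ^ 2 ∣ ·) with hA
  have hcard : (squareDivisible M k).card ≤ 2 * A.card := by
    have h := finite_and_ncard_le_of_injOn (S := (squareDivisible M k : Set ℤ))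
      (fun m : ℤ => (m.natAbs, decide (0 ≤ m))) (A ×ˢ Finset.univ) ?_ ?_
    · have h2 := h.2
      rw [Set.ncard_coe_finset, Finset.card_product, Finset.card_univ, Fintype.card_bool] at h2
      omega
    · intro m hm
      rw [Finset.mem_coe, mem_squareDivisible] at hm
      obtain ⟨hmM, hm0, r, hkr, hr⟩ := hm
      rw [Int.abs_eq_natAbs] at hmM
      have hpos : 0 < m.natAbs := Int.natAbs_pos.2 hm0
      have hle : r ≤ m.natAbs :=
        (Nat.le_self_pow two_ne_zero r).trans (Nat.le_of_dvd hpos hr)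
      simp only [A, Finset.mem_product, Finset.mem_univ, and_true, Finset.mem_biUnion,
        Finset.mem_filter, Finset.mem_Ioc]
      exact ⟨r, ⟨hkr, by omega⟩, ⟨hpos, by omega⟩, hr⟩
    · intro m _ m' _ h
      simp only [Prod.mk.injEq, decide_eq_decide] at h
      omega
  have hsum : (A.card : ℝ) ≤ M / k := by
    rcases le_or_gt k M with hkM | hkM
    · have hbi : A.card ≤ ∑ r ∈ Finset.Ioc k M, M / r ^ 2 := by
        refine Finset.card_biUnion_le.trans (Finset.sum_le_sum fun r _ => ?_)
        rw [Nat.Ioc_filter_dvd_card_eq_div]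
      have hs := sum_Ioc_inv_sq_le_sub (α := ℝ) hk hkM
      calc (A.card : ℝ) ≤ ∑ r ∈ Finset.Ioc k M, ((M / r ^ 2 : ℕ) : ℝ) := by exact_mod_cast hbi
        _ ≤ ∑ r ∈ Finset.Ioc k M, (M : ℝ) * ((r : ℝ) ^ 2)⁻¹ := by
          refine Finset.sum_le_sum fun r _ => Nat.cast_div_le.trans_eq ?_
          push_cast
          rw [div_eq_mul_inv]
        _ = M * ∑ r ∈ Finset.Ioc k M, ((r : ℝ) ^ 2)⁻¹ := by rw [Finset.mul_sum]
        _ ≤ M * (k : ℝ)⁻¹ := by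
          refine mul_le_mul_of_nonneg_left (hs.trans ?_) (Nat.cast_nonneg _)
          exact sub_le_self _ (by positivity)
        _ = M / k := by rw [div_eq_mul_inv]
    · rw [hA, Finset.Ioc_eq_empty (by omega)]
      simp
      positivity
  calc ((squareDivisible M k).card : ℝ) ≤ 2 * A.card := by exact_mod_cast hcard
    _ ≤ 2 * (M / k) := by gcongr
    _ = _ := by ring

theorem ncard_le_card_mul_of_trZ_mem {S : Set SL2Z} (hS : S.Finite) {A : Finset ℤ}
    (hA : ∀ γ ∈ S, trZ γ ∈ A) {b : ℝ} (hb0 : 0 ≤ b)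
    (hb : ∀ γ ∈ S, ({δ ∈ S | trZ δ = trZ γ}.ncard : ℝ) ≤ b) : (S.ncard : ℝ) ≤ b * A.card := by
  have h := Finset.card_le_mul_card_image_of_maps_to (s := hS.toFinset) (t := A) (f := trZ)
    (fun γ hγ => hA γ (hS.mem_toFinset.1 hγ)) ⌊b⌋₊ ?_
  · rw [← Set.ncard_eq_toFinset_card _ hS] at h
    calc (S.ncard : ℝ) ≤ ⌊b⌋₊ * A.card := by exact_mod_cast h
      _ ≤ b * A.card := by gcongr; exact Nat.floor_le hb0
  · intro t _
    rcases Finset.eq_empty_or_nonempty (hS.toFinset.filter fun γ => trZ γ = t) with h0 | ⟨γ, hγ⟩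
    · rw [h0]; simp
    · rw [Finset.mem_filter, hS.mem_toFinset] at hγ
      have h1 := Nat.le_floor (hb γ hγ.1)
      rw [← hγ.2]
      refine le_trans (le_of_eq ?_) h1
      rw [← Set.ncard_coe_finset]
      congr 1
      ext δ
      simp

theorem sq_div_le_ncard_frobNorm_le {C δ T : ℝ} (hδ : 0 ≤ δ) (hC1 : 1 ≤ C)
    (hC : ∀ n : ℕ, n ≠ 0 → (n.divisors.card : ℝ) ≤ C * (n : ℝ) ^ δ) (hT : 4 ≤ T) :
    T ^ 2 / (32 * C * T ^ δ) ≤ ({γ : SL2Z | frobNorm γ ≤ T}.ncard : ℝ) := by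
  set N := ⌊T / 2⌋₊ with hN
  have hN1 : (N : ℝ) ≤ T / 2 := Nat.floor_le (by linarith)
  have hN2 : T / 4 ≤ N := by
    have := Nat.lt_floor_add_one (T / 2)
    linarith
  have hmono : {γ : SL2Z | frobNorm γ ≤ 2 * N}.ncard ≤ {γ : SL2Z | frobNorm γ ≤ T}.ncard :=
    Set.ncard_le_ncard (fun γ (hγ : frobNorm γ ≤ 2 * N) => show frobNorm γ ≤ T by linarith)
      (finite_frobNorm_le T)
  have hφ : ∀ n ∈ Finset.Icc 1 N, (n : ℝ) ≤ C * T ^ δ * n.totient := by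
    intro n hn
    rw [Finset.mem_Icc] at hn
    have hnT : (n : ℝ) ≤ T := by
      have : (n : ℝ) ≤ N := by exact_mod_cast hn.2
      linarith
    have h1 : (n : ℝ) ≤ n.divisors.card * n.totient := by
      exact_mod_cast le_card_divisors_mul_totient (by omega)
    refine h1.trans (mul_le_mul_of_nonneg_right ((hC n (by omega)).trans ?_) (by positivity))
    gcongr
  have hsum : (N : ℝ) ^ 2 / 2 ≤ ∑ n ∈ Finset.Icc 1 N, (n : ℝ) := by
    clear_value N
    clear hmono hφ hN hN1 hN2
    induction N with
    | zero => simp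
    | succ k ih =>
      rw [Finset.sum_Icc_succ_top (by omega)]
      push_cast
      nlinarith
  have hpos : 0 < C * T ^ δ := by positivity
  have htot : (∑ n ∈ Finset.Icc 1 N, (n.totient : ℝ)) ≤
      {γ : SL2Z | frobNorm γ ≤ T}.ncard := by
    exact_mod_cast (sum_totient_le_ncard N).trans hmono
  have h2 : (N : ℝ) ^ 2 / 2 ≤ C * T ^ δ * ({γ : SL2Z | frobNorm γ ≤ T}.ncard : ℝ) := by
    refine hsum.trans ((Finset.sum_le_sum hφ).trans ?_)
    rw [← Finset.mul_sum]
    exact mul_le_mul_of_nonneg_left htot hpos.le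
  rw [div_le_iff₀ (by positivity)]
  nlinarith

theorem mul_sq_rpow_le {a δ T : ℝ} (ha : 1 ≤ a) (hδ1 : δ ≤ 1) (hT : 0 ≤ T) :
    (a * T ^ 2) ^ δ ≤ a * (T ^ δ) ^ 2 := by
  have h0 : 0 ≤ a := by linarith
  rw [Real.mul_rpow h0 (sq_nonneg T), ← Real.rpow_natCast T 2, ← Real.rpow_mul hT,
    mul_comm _ δ, Real.rpow_mul hT, Real.rpow_natCast]
  exact mul_le_mul_of_nonneg_right (Real.rpow_le_self_of_one_le ha hδ1) (by positivity)

theorem abs_trZ_le {γ : SL2Z} {T : ℝ} (h : frobNorm γ ≤ T) : |(trZ γ : ℝ)| ≤ 2 * T := by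
  have h0 := abs_entry_le_frobNorm γ 0 0
  have h1 := abs_entry_le_frobNorm γ 1 1
  have h2 := abs_add_le (γ 0 0 : ℝ) (γ 1 1 : ℝ)
  rw [trZ, Int.cast_add]
  linarith

theorem quadClassNumber_le_mul {C δ T : ℝ} (hδ : 0 ≤ δ) (hδ1 : δ ≤ 1) (hC1 : 1 ≤ C)
    (hC : ∀ n : ℕ, n ≠ 0 → (n.divisors.card : ℝ) ≤ C * (n : ℝ) ^ δ) (hT : 1 ≤ T) {t : ℤ}
    (ht : 2 < |t|) (htT : |(t : ℝ)| ≤ 2 * T) :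
    (quadClassNumber t : ℝ) ≤ 160 * C * T * (T ^ δ) ^ 2 := by
  have h := quadClassNumber_le ht hδ hC1 hC
  have hn : (t.natAbs : ℝ) ≤ 2 * T := by rwa [Nat.cast_natAbs, Int.cast_abs]
  refine h.trans ?_
  have h2 : (4 * (t.natAbs : ℝ) ^ 2) ^ δ ≤ 16 * (T ^ δ) ^ 2 := by
    refine le_trans ?_ (mul_sq_rpow_le (by norm_num) hδ1 (by linarith))
    refine Real.rpow_le_rpow (by positivity) ?_ hδ
    calc 4 * (t.natAbs : ℝ) ^ 2 ≤ 4 * (2 * T) ^ 2 := by gcongr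
      _ = _ := by ring
  calc (2 * t.natAbs + 1 : ℝ) * (2 * (C * (4 * (t.natAbs : ℝ) ^ 2) ^ δ))
      ≤ (5 * T) * (2 * (C * (16 * (T ^ δ) ^ 2))) := by gcongr; linarith
    _ = _ := by ring

theorem ncard_trZ_mem_le {C δ T : ℝ} (hδ : 0 ≤ δ) (hδ1 : δ ≤ 1) (hC1 : 1 ≤ C)
    (hC : ∀ n : ℕ, n ≠ 0 → (n.divisors.card : ℝ) ≤ C * (n : ℝ) ^ δ) (hT : 1 ≤ T)
    (A : Finset ℤ) :
    ({γ : SL2Z | frobNorm γ ≤ T ∧ γ 0 0 * γ 1 1 ≠ 1 ∧ trZ γ ∈ A}.ncard : ℝ) ≤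
      24 * C * T * (T ^ δ) ^ 2 * A.card := by
  refine ncard_le_card_mul_of_trZ_mem ((finite_frobNorm_le T).subset fun γ h => h.1)
    (fun γ h => h.2.2) (by positivity) ?_
  intro γ hγ
  have hN1 : 1 ≤ ⌊T⌋₊ := Nat.le_floor (by exact_mod_cast hT)
  have hNT : (⌊T⌋₊ : ℝ) ≤ T := Nat.floor_le (by linarith)
  have htr : |trZ γ| ≤ 2 * (⌊T⌋₊ : ℕ) := by
    have h0 := abs_entry_le_floor hγ.1 0 0
    have h1 := abs_entry_le_floor hγ.1 1 1
    have h2 := abs_add_le (γ 0 0) (γ 1 1)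
    rw [trZ]
    linarith
  have h := ncard_trZ_eq_le hδ hC hC1 hN1 htr
  have hsub := Set.ncard_le_ncard (s := {δ ∈ {γ : SL2Z | frobNorm γ ≤ T ∧ γ 0 0 * γ 1 1 ≠ 1 ∧
      trZ γ ∈ A} | trZ δ = trZ γ})
    (by intro δ hδ; exact ⟨hδ.2, hδ.1.2.1, abs_entry_le_floor hδ.1.1 0 0⟩) h.1
  refine (Nat.cast_le.2 hsub).trans (h.2.trans ?_)
  have h2 : (4 * (⌊T⌋₊ : ℝ) ^ 2) ^ δ ≤ 4 * (T ^ δ) ^ 2 := by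
    refine le_trans ?_ (mul_sq_rpow_le (by norm_num) hδ1 (by linarith))
    refine Real.rpow_le_rpow (by positivity) ?_ hδ
    gcongr
  calc (2 * ⌊T⌋₊ + 1 : ℝ) * (2 * (C * (4 * (⌊T⌋₊ : ℝ) ^ 2) ^ δ))
      ≤ (3 * T) * (2 * (C * (4 * (T ^ δ) ^ 2))) := by gcongr; linarith
    _ = _ := by ring

/-- The traces `t` which are small, or for which `t² - 4` has a large square divisor. -/
def exceptionalTraces (T X : ℝ) : Finset ℤ :=
  Finset.Icc (-(⌊T / X⌋₊ : ℤ)) ⌊T / X⌋₊ ∪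
    ((squareDivisible ⌊4 * T⌋₊ ⌊X⌋₊).image (· + 2) ∪
      (squareDivisible ⌊4 * T⌋₊ ⌊X⌋₊).image (· - 2))

theorem card_exceptionalTraces_le {T X : ℝ} (hX : 1 ≤ X) (hXT : X ≤ T) :
    ((exceptionalTraces T X).card : ℝ) ≤ 35 * T / X := by
  have hX0 : 0 < X := by linarith
  have h1 : (exceptionalTraces T X).card ≤
      (2 * ⌊T / X⌋₊ + 1) + 2 * (squareDivisible ⌊4 * T⌋₊ ⌊X⌋₊).card := by
    refine (Finset.card_union_le _ _).trans (add_le_add ?_ ?_)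
    · rw [Int.card_Icc]; omega
    · refine (Finset.card_union_le _ _).trans ?_
      have a := Finset.card_image_le (s := squareDivisible ⌊4 * T⌋₊ ⌊X⌋₊) (f := (· + 2))
      have b := Finset.card_image_le (s := squareDivisible ⌊4 * T⌋₊ ⌊X⌋₊) (f := (· - 2))
      omega
  have hk : 1 ≤ ⌊X⌋₊ := Nat.le_floor (by exact_mod_cast hX)
  have hk1 : (1 : ℝ) ≤ ⌊X⌋₊ := by exact_mod_cast hk
  have hk2 : X / 2 ≤ ⌊X⌋₊ := by
    have := Nat.lt_floor_add_one X
    linarith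
  have h2 : ((squareDivisible ⌊4 * T⌋₊ ⌊X⌋₊).card : ℝ) ≤ 16 * (T / X) := by
    refine (card_squareDivisible_le (by omega)).trans ?_
    have hT4 : (⌊4 * T⌋₊ : ℝ) ≤ 4 * T := Nat.floor_le (by linarith)
    have hT0 : 0 ≤ 4 * T := by linarith
    calc (2 * (⌊4 * T⌋₊ : ℝ)) / ⌊X⌋₊ ≤ (2 * (4 * T)) / (X / 2) := by gcongr
      _ = _ := by field_simp; ring
  have h3 : (⌊T / X⌋₊ : ℝ) ≤ T / X := Nat.floor_le (div_nonneg (by linarith) hX0.le)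
  have h4 : 1 ≤ T / X := by rwa [one_le_div hX0]
  calc ((exceptionalTraces T X).card : ℝ)
      ≤ (2 * ⌊T / X⌋₊ + 1) + 2 * (squareDivisible ⌊4 * T⌋₊ ⌊X⌋₊).card := by exact_mod_cast h1
    _ ≤ 35 * (T / X) := by linarith
    _ = _ := by ring

/-- Outside the exceptional traces, `t² - 4` is large and almost squarefree. -/
theorem exists_square_parts_of_notMem {T X : ℝ} {t : ℤ} (ht : 2 < |t|)
    (htT : |(t : ℝ)| ≤ 2 * T) (hX : 0 ≤ X) (h : t ∉ exceptionalTraces T X) :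
    T / X < |(t : ℝ)| ∧ ∃ r₁ s₁ r₂ s₂ : ℕ, (t - 2).natAbs = r₁ ^ 2 * s₁ ∧
      (t + 2).natAbs = r₂ ^ 2 * s₂ ∧ Squarefree s₁ ∧ Squarefree s₂ ∧ r₁ ≤ X ∧ r₂ ≤ X := by
  have key : ∀ m : ℤ, m ≠ 0 → |(m : ℝ)| ≤ 4 * T → m ∉ squareDivisible ⌊4 * T⌋₊ ⌊X⌋₊ →
      ∃ r s : ℕ, m.natAbs = r ^ 2 * s ∧ Squarefree s ∧ r ≤ X := by
    intro m hm0 hmT hm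
    obtain ⟨s, r, hsr, hs⟩ := Nat.sq_mul_squarefree m.natAbs
    refine ⟨r, s, hsr.symm, hs, ?_⟩
    by_contra! hr
    apply hm
    rw [mem_squareDivisible]
    refine ⟨abs_int_le_floor hmT, hm0, r, (Nat.floor_lt hX).2 hr, ?_⟩
    exact ⟨s, hsr.symm⟩
  rw [exceptionalTraces, Finset.mem_union, Finset.mem_union, not_or, not_or] at h
  obtain ⟨h0, h1, h2⟩ := h
  have hne : t ≠ 2 ∧ t ≠ -2 := by
    constructor <;> rintro rfl <;> norm_num at ht
  have ht3 : (3 : ℝ) ≤ |(t : ℝ)| := by exact_mod_cast ht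
  have hb := abs_le.1 htT
  obtain ⟨r₁, s₁, e₁, hs₁, hr₁⟩ := key (t - 2) (by omega)
    (by push_cast; rw [abs_le]; constructor <;> linarith)
    (fun hm => h1 (Finset.mem_image.2 ⟨_, hm, by ring⟩))
  obtain ⟨r₂, s₂, e₂, hs₂, hr₂⟩ := key (t + 2) (by omega)
    (by push_cast; rw [abs_le]; constructor <;> linarith)
    (fun hm => h2 (Finset.mem_image.2 ⟨_, hm, by ring⟩))
  refine ⟨?_, r₁, s₁, r₂, s₂, e₁, e₂, hs₁, hs₂, hr₁, hr₂⟩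
  by_contra! hle
  exact h0 (Finset.mem_Icc.2 (abs_le.1 (abs_int_le_floor hle)))

theorem ncard_small_quadClassNumber_le {T X ε H : ℝ} (hε : 0 < ε) (hX : X = T ^ ε) (hε1 : ε ≤ 1)
    (hT : 1 ≤ T) (hXT : 4 * X ≤ T) (hH : 0 ≤ H) :
    ({γ : SL2Z | frobNorm γ ≤ T ∧ 2 < |trZ γ| ∧ trZ γ ∉ exceptionalTraces T X ∧
      (quadClassNumber (trZ γ) : ℝ) ≤ H}.ncard : ℝ) ≤
      5 * 1025 ^ 4 * (6 / ε + 1) * T * X ^ 21 * H := by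
  have hX1 : 1 ≤ X := hX ▸ Real.one_le_rpow hT hε.le
  have hX0 : 0 < X := by linarith
  have hNT : (⌊2 * T⌋₊ : ℝ) ≤ 2 * T := Nat.floor_le (by linarith)
  have hcard : ((Finset.Icc (-(⌊2 * T⌋₊ : ℤ)) ⌊2 * T⌋₊).card : ℝ) ≤ 5 * T := by
    rw [Int.card_Icc, show ((⌊2 * T⌋₊ : ℤ) + 1 - -(⌊2 * T⌋₊ : ℤ)).toNat = 2 * ⌊2 * T⌋₊ + 1 by omega]
    push_cast
    linarith
  refine (ncard_le_card_mul_of_trZ_mem (A := Finset.Icc (-(⌊2 * T⌋₊ : ℤ)) ⌊2 * T⌋₊)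
    (b := (1025 * X ^ 5) ^ 4 * (H * ((6 / ε + 1) * X)))
    ((finite_frobNorm_le T).subset fun γ h => h.1)
    (fun γ h => Finset.mem_Icc.2 (abs_le.1 (abs_int_le_floor (abs_trZ_le h.1))))
    (by positivity) ?_).trans ?_
  · rintro γ ⟨hγ, ht, hex, hle⟩
    have htT := abs_trZ_le hγ
    obtain ⟨hlt, r₁, s₁, r₂, s₂, e₁, e₂, hs₁, hs₂, hr₁, hr₂⟩ :=
      exists_square_parts_of_notMem ht htT hX0.le hex
    have hQ : T ^ 2 ≤ (2 * X) ^ 2 * ((trZ γ : ℝ) ^ 2 - 4) := by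
      have h1 : T < |(trZ γ : ℝ)| * X := by rwa [div_lt_iff₀ hX0] at hlt
      have h2 : T ^ 2 ≤ (|(trZ γ : ℝ)| * X) ^ 2 := by gcongr
      rw [mul_pow, sq_abs] at h2
      nlinarith
    have h := ncard_trZ_eq_frobNorm_le_of_square_parts ht e₁ e₂ hs₁ hs₂ hr₁ hr₂
      (by positivity) hQ
    have hfin : {δ : SL2Z | trZ δ = trZ γ ∧ frobNorm δ ≤ T}.Finite :=
      (finite_frobNorm_le T).subset fun γ h => h.2
    have hsub := Set.ncard_le_ncard (s := {δ ∈ {γ : SL2Z | frobNorm γ ≤ T ∧ 2 < |trZ γ| ∧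
      trZ γ ∉ exceptionalTraces T X ∧ (quadClassNumber (trZ γ) : ℝ) ≤ H} | trZ δ = trZ γ})
      (by intro δ hδ; exact ⟨hδ.2, hδ.1.1⟩) hfin
    refine (Nat.cast_le.2 hsub).trans (h.trans ?_)
    have hlog : Real.log ((|trZ γ| : ℤ) + 1) ≤ 3 * X / ε := by
      push_cast
      have h3 : Real.log (|(trZ γ : ℝ)| + 1) ≤ (|(trZ γ : ℝ)| + 1) ^ ε / ε :=
        Real.log_le_rpow_div (by positivity) hε
      refine h3.trans ?_
      gcongr
      calc (|(trZ γ : ℝ)| + 1) ^ ε ≤ (3 * T) ^ ε := by gcongr; linarith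
        _ = 3 ^ ε * X := by rw [Real.mul_rpow (by norm_num) (by linarith), hX]
        _ ≤ 3 * X := by
          gcongr
          exact Real.rpow_le_self_of_one_le (by norm_num) hε1
    have hpow : (1 : ℝ) ≤ X ^ 5 := one_le_pow₀ hX1
    have hl0 : 0 ≤ Real.log ((|trZ γ| : ℤ) + 1) :=
      Real.log_nonneg (by push_cast; linarith [abs_nonneg (trZ γ : ℝ)])
    gcongr
    · nlinarith
    · calc 2 * Real.log ((|trZ γ| : ℤ) + 1) + 1 ≤ 2 * (3 * X / ε) + X := by linarith
        _ = _ := by ring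
  · calc (1025 * X ^ 5) ^ 4 * (H * ((6 / ε + 1) * X)) *
        ((Finset.Icc (-(⌊2 * T⌋₊ : ℤ)) ⌊2 * T⌋₊).card : ℝ)
        ≤ (1025 * X ^ 5) ^ 4 * (H * ((6 / ε + 1) * X)) * (5 * T) := by gcongr
      _ = _ := by ring

theorem ncard_bad_le {η C δ T D : ℝ} (hδ : 0 < δ) (hδ1 : 4 * δ ≤ 1) (hδη : 96 * δ ≤ η)
    (hC1 : 1 ≤ C) (hC : ∀ n : ℕ, n ≠ 0 → (n.divisors.card : ℝ) ≤ C * (n : ℝ) ^ δ)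
    (hT : 1 < T) (hD : D = T ^ δ) (hCD : 160 * C ≤ D) (hDT : 4 * D ^ 4 ≤ T) :
    ({γ : SL2Z | frobNorm γ ≤ T ∧ ¬ (2 < |trZ γ| ∧
      |Real.log (hK γ) / Real.log T - 1| ≤ η)}.ncard : ℝ) ≤
      (12 + 840 * C + 5 * 1025 ^ 4 * (6 / (4 * δ) + 1)) * (T ^ 2 / D ^ 2) := by
  have hD1 : 1 ≤ D := by linarith
  have hD0 : 0 < D := by linarith
  have hT0 : 0 < T := by linarith
  have hX : D ^ 4 = T ^ (4 * δ) := by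
    rw [hD, ← Real.rpow_mul_natCast hT0.le]
    congr 1
    push_cast
    ring
  have hX1 : 1 ≤ D ^ 4 := one_le_pow₀ hD1
  have hlogT : 0 < Real.log T := Real.log_pos hT
  have hlogD : Real.log D = δ * Real.log T := by rw [hD, Real.log_rpow hT0]
  set S₀ := {γ : SL2Z | frobNorm γ ≤ T ∧ γ 0 0 * γ 1 1 = 1} with hS₀
  set S₁ := {γ : SL2Z | frobNorm γ ≤ T ∧ γ 0 0 * γ 1 1 ≠ 1 ∧ trZ γ ∈ exceptionalTraces T (D ^ 4)}
    with hS₁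
  set S₂ := {γ : SL2Z | frobNorm γ ≤ T ∧ 2 < |trZ γ| ∧ trZ γ ∉ exceptionalTraces T (D ^ 4) ∧
      (quadClassNumber (trZ γ) : ℝ) ≤ T / D ^ 96} with hS₂
  have hf₀ : S₀.Finite := (finite_frobNorm_le T).subset fun γ h => h.1
  have hf₁ : S₁.Finite := (finite_frobNorm_le T).subset fun γ h => h.1
  have hf₂ : S₂.Finite := (finite_frobNorm_le T).subset fun γ h => h.1
  have hcover : {γ : SL2Z | frobNorm γ ≤ T ∧ ¬ (2 < |trZ γ| ∧
      |Real.log (hK γ) / Real.log T - 1| ≤ η)} ⊆ S₀ ∪ (S₁ ∪ S₂) := by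
    rintro γ ⟨hγ, hbad⟩
    by_cases h0 : γ 0 0 * γ 1 1 = 1
    · exact Or.inl ⟨hγ, h0⟩
    by_cases h1 : trZ γ ∈ exceptionalTraces T (D ^ 4)
    · exact Or.inr (Or.inl ⟨hγ, h0, h1⟩)
    have ht : 2 < |trZ γ| := by
      by_contra! hle
      apply h1
      rw [exceptionalTraces, Finset.mem_union, Finset.mem_Icc, ← abs_le]
      left
      apply abs_int_le_floor
      rw [le_div_iff₀ (by positivity)]
      have : |(trZ γ : ℝ)| ≤ 2 := by exact_mod_cast hle
      nlinarith
    refine Or.inr (Or.inr ⟨hγ, ht, h1, ?_⟩)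
    have hbad' : η < |Real.log (quadClassNumber (trZ γ)) / Real.log T - 1| := by
      by_contra! h
      exact hbad ⟨ht, h⟩
    have hpos : (0 : ℝ) < quadClassNumber (trZ γ) := by exact_mod_cast quadClassNumber_pos ht
    have hup : Real.log (quadClassNumber (trZ γ)) ≤ Real.log T + 3 * Real.log D := by
      have h := quadClassNumber_le_mul hδ.le (by linarith) hC1 hC hT.le ht (abs_trZ_le hγ)
      rw [← hD] at h
      have h' : (quadClassNumber (trZ γ) : ℝ) ≤ T * D ^ 3 := by
        refine h.trans ?_
        have := mul_le_mul_of_nonneg_right hCD (by positivity : 0 ≤ T * D ^ 2)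
        nlinarith
      have := Real.log_le_log hpos h'
      rwa [Real.log_mul hT0.ne' (by positivity), Real.log_pow] at this
    have hδη' : 96 * δ * Real.log T ≤ η * Real.log T := by gcongr
    have hδ0 : 0 < δ * Real.log T := by positivity
    rcases lt_abs.1 hbad' with h | h
    · exfalso
      rw [lt_sub_iff_add_lt, lt_div_iff₀ hlogT] at h
      rw [hlogD] at hup
      nlinarith
    · rw [neg_sub, lt_sub_comm, div_lt_iff₀ hlogT] at h
      rw [← Real.log_le_log_iff hpos (by positivity), Real.log_div hT0.ne' (by positivity),
        Real.log_pow, hlogD]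
      push_cast
      nlinarith
  have hT2 : 0 ≤ T ^ 2 / D ^ 2 := by positivity
  have b₀ : (S₀.ncard : ℝ) ≤ 12 * (T ^ 2 / D ^ 2) := by
    have hfin : {γ : SL2Z | γ 0 0 * γ 1 1 = 1 ∧ ∀ i j, |γ i j| ≤ (⌊T⌋₊ : ℤ)}.Finite := by
      refine (finite_frobNorm_le (2 * ⌊T⌋₊)).subset ?_
      rintro γ ⟨-, hγ⟩
      have e : ∀ i j, (γ i j : ℝ) ^ 2 ≤ (⌊T⌋₊ : ℝ) ^ 2 := fun i j =>
        sq_le_sq' (by exact_mod_cast (abs_le.1 (hγ i j)).1) (by exact_mod_cast (abs_le.1 (hγ i j)).2)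
      refine (abs_le_of_sq_le_sq' (a := frobNorm γ) ?_ (by positivity)).2
      rw [sq_frobNorm]
      linarith [e 0 0, e 0 1, e 1 0, e 1 1]
    have h := (Set.ncard_le_ncard (s := S₀)
      (by intro γ hγ; exact ⟨hγ.2, abs_entry_le_floor hγ.1⟩) hfin).trans
      (ncard_diag_mul_eq_one_le ⌊T⌋₊)
    have hNT : (⌊T⌋₊ : ℝ) ≤ T := Nat.floor_le hT0.le
    have hDT' : T ≤ T ^ 2 / D ^ 2 := by
      rw [le_div_iff₀ (by positivity), sq T]
      gcongr
      nlinarith [one_le_pow₀ hD1 (n := 2)]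
    calc (S₀.ncard : ℝ) ≤ 4 * (2 * ⌊T⌋₊ + 1) := by exact_mod_cast h
      _ ≤ 12 * T := by linarith
      _ ≤ _ := by gcongr
  have b₁ : (S₁.ncard : ℝ) ≤ 840 * C * (T ^ 2 / D ^ 2) := by
    have h := ncard_trZ_mem_le hδ.le (by linarith) hC1 hC hT.le (exceptionalTraces T (D ^ 4))
    rw [← hD] at h
    calc (S₁.ncard : ℝ) ≤ 24 * C * T * D ^ 2 * (exceptionalTraces T (D ^ 4)).card := h
      _ ≤ 24 * C * T * D ^ 2 * (35 * T / D ^ 4) := by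
        gcongr
        exact card_exceptionalTraces_le hX1 (by linarith)
      _ = _ := by field_simp; ring
  have b₂ : (S₂.ncard : ℝ) ≤ 5 * 1025 ^ 4 * (6 / (4 * δ) + 1) * (T ^ 2 / D ^ 2) := by
    calc (S₂.ncard : ℝ)
        ≤ 5 * 1025 ^ 4 * (6 / (4 * δ) + 1) * T * (D ^ 4) ^ 21 * (T / D ^ 96) :=
        ncard_small_quadClassNumber_le (by positivity) hX hδ1 hT.le hDT (by positivity)
      _ = 5 * 1025 ^ 4 * (6 / (4 * δ) + 1) * (T ^ 2 / D ^ 12) := by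
        rw [show D ^ 96 = (D ^ 4) ^ 21 * D ^ 12 by ring]
        field_simp
      _ ≤ _ := by
        have : D ^ 2 ≤ D ^ 12 := pow_le_pow_right₀ hD1 (by norm_num)
        gcongr
  have hsub := (Set.ncard_le_ncard hcover (hf₀.union (hf₁.union hf₂))).trans
    ((Set.ncard_union_le _ _).trans (Nat.add_le_add_left (Set.ncard_union_le _ _) _))
  calc _ ≤ ((S₀.ncard + (S₁.ncard + S₂.ncard) : ℕ) : ℝ) := Nat.cast_le.2 hsub
    _ ≤ _ := by push_cast; linarith

/-- `log h_K(γ) / log T` converges in probability to `1` as `T → ∞`: for every `η > 0`,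
the proportion of `γ ∈ Γ_T` which are hyperbolic with `|log h_K(γ)/log T - 1| ≤ η`
tends to `1`. -/
theorem statement11 (η : ℝ) (hη : 0 < η) :
    Tendsto (fun T : ℝ =>
        (Nat.card {γ : SL2Z // frobNorm γ ≤ T ∧ 2 < |trZ γ| ∧
            |Real.log (hK γ) / Real.log T - 1| ≤ η} : ℝ) /
          (Nat.card {γ : SL2Z // frobNorm γ ≤ T} : ℝ))
      atTop (𝓝 1) := by
  set δ : ℝ := min (η / 96) (1 / 16) with hδ_def
  have hδ : 0 < δ := by positivity
  have hδη : 96 * δ ≤ η := by linarith [min_le_left (η / 96) (1 / 16)]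
  have hδ1 : δ ≤ 1 / 16 := min_le_right _ _
  obtain ⟨C, hC1, hC⟩ := exists_card_divisors_le_rpow hδ
  set A := 12 + 840 * C + 5 * 1025 ^ 4 * (6 / (4 * δ) + 1) with hA
  have hA0 : 0 < A := by positivity
  have hDlim : Tendsto (fun T : ℝ => T ^ δ) atTop atTop := tendsto_rpow_atTop hδ
  have hlim : Tendsto (fun T : ℝ => 1 - 32 * C * A / T ^ δ) atTop (𝓝 1) := by
    simpa using tendsto_const_nhds.sub (hDlim.const_div_atTop (32 * C * A))
  have hDT : ∀ᶠ T : ℝ in atTop, 4 * (T ^ δ) ^ 4 ≤ T := by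
    filter_upwards [(tendsto_rpow_atTop (show (0 : ℝ) < 3 / 4 by norm_num)).eventually_ge_atTop 4,
      eventually_ge_atTop 1] with T h4 hT
    have hT0 : 0 < T := by linarith
    calc 4 * (T ^ δ) ^ 4 ≤ T ^ (3 / 4 : ℝ) * (T ^ (1 / 16 : ℝ)) ^ 4 := by gcongr
      _ = T := by
        rw [← Real.rpow_mul_natCast hT0.le, ← Real.rpow_add hT0]
        norm_num
  have key : ∀ᶠ T : ℝ in atTop, 1 - 32 * C * A / T ^ δ ≤
      (Nat.card {γ : SL2Z // frobNorm γ ≤ T ∧ 2 < |trZ γ| ∧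
        |Real.log (hK γ) / Real.log T - 1| ≤ η} : ℝ) /
      (Nat.card {γ : SL2Z // frobNorm γ ≤ T} : ℝ) := by
    filter_upwards [hDT, hDlim.eventually_ge_atTop (160 * C), eventually_ge_atTop 4]
      with T h1 h2 h3
    have hT0 : 0 < T := by linarith
    have hbad := ncard_bad_le hδ (by linarith) hδη hC1 hC (by linarith) rfl h2 h1
    have htot := sq_div_le_ncard_frobNorm_le hδ.le hC1 hC h3
    have hpos : 0 < T ^ 2 / (32 * C * T ^ δ) := by positivity
    have hunion : {γ : SL2Z | frobNorm γ ≤ T}.ncard ≤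
        {γ : SL2Z | frobNorm γ ≤ T ∧ 2 < |trZ γ| ∧
          |Real.log (hK γ) / Real.log T - 1| ≤ η}.ncard +
        {γ : SL2Z | frobNorm γ ≤ T ∧ ¬ (2 < |trZ γ| ∧
          |Real.log (hK γ) / Real.log T - 1| ≤ η)}.ncard := by
      refine le_trans (Set.ncard_le_ncard ?_ ?_) (Set.ncard_union_le _ _)
      · intro γ hγ
        by_cases h : 2 < |trZ γ| ∧ |Real.log (hK γ) / Real.log T - 1| ≤ η
        · exact Or.inl ⟨hγ, h⟩
        · exact Or.inr ⟨hγ, h⟩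
      · exact ((finite_frobNorm_le T).subset fun γ h => h.1).union
          ((finite_frobNorm_le T).subset fun γ h => h.1)
    have hunion' : ({γ : SL2Z | frobNorm γ ≤ T}.ncard : ℝ) ≤ _ := Nat.cast_le.2 hunion
    push_cast at hunion'
    have hratio : A * (T ^ 2 / (T ^ δ) ^ 2) ≤
        32 * C * A / T ^ δ * ({γ : SL2Z | frobNorm γ ≤ T}.ncard : ℝ) := by
      calc A * (T ^ 2 / (T ^ δ) ^ 2) = 32 * C * A / T ^ δ * (T ^ 2 / (32 * C * T ^ δ)) := by
            field_simp
        _ ≤ _ := by gcongr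
    change _ ≤ ({γ : SL2Z | frobNorm γ ≤ T ∧ 2 < |trZ γ| ∧
      |Real.log (hK γ) / Real.log T - 1| ≤ η}.ncard : ℝ) /
      ({γ : SL2Z | frobNorm γ ≤ T}.ncard : ℝ)
    rw [le_div_iff₀ (hpos.trans_le htot)]
    linarith
  refine tendsto_of_tendsto_of_tendsto_of_le_of_le' hlim tendsto_const_nhds key ?_
  refine Eventually.of_forall fun T => div_le_one_of_le₀ ?_ (Nat.cast_nonneg _)
  exact Nat.cast_le.2 (Set.ncard_le_ncard (fun γ h => h.1) (finite_frobNorm_le T))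
end
end

section
/- Let p be a prime, k ≥ 1 an integer, ε ∈ {1, −1}, and let γ ∈ SL(2,ℤ) satisfy γ ≡ ε·I₂ (mod p^k). Then Tr(γ) ≡ 2ε (mod p^{2k}). -/
noncomputable section

open Matrix

/-- If `p` is prime, `k ≥ 1`, `ε = ±1` and `γ ∈ SL(2,ℤ)` satisfies
`γ ≡ ε·I₂ (mod p^k)`, then `Tr(γ) ≡ 2ε (mod p^{2k})`. -/
theorem statement14 (p : ℕ) (hp : p.Prime) (k : ℕ) (hk : 1 ≤ k)
    (ε : ℤ) (hε : ε = 1 ∨ ε = -1) (γ : SL2Z)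
    (h : ∀ i j, (p : ℤ) ^ k ∣
      ((γ : Matrix (Fin 2) (Fin 2) ℤ) - ε • (1 : Matrix (Fin 2) (Fin 2) ℤ)) i j) :
    (p : ℤ) ^ (2 * k) ∣ (trZ γ - 2 * ε) := by
  have h00 := h 0 0
  have h01 := h 0 1
  have h10 := h 1 0
  have h11 := h 1 1
  simp only [Matrix.sub_apply, Matrix.smul_apply, Matrix.one_apply_eq, smul_eq_mul, mul_one,
    ne_eq, zero_ne_one, one_ne_zero, not_false_eq_true, Matrix.one_apply_ne, mul_zero,
    sub_zero] at h00 h01 h10 h11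
  obtain ⟨x, hx⟩ := h00
  obtain ⟨y, hy⟩ := h01
  obtain ⟨z, hz⟩ := h10
  obtain ⟨w, hw⟩ := h11
  have hdet := γ.det_coe
  rw [Matrix.det_fin_two, hy, hz, eq_add_of_sub_eq hx, eq_add_of_sub_eq hw] at hdet
  have hε_sq : ε * ε = 1 := by rcases hε with rfl | rfl <;> norm_num
  refine ⟨-ε * (x * w - y * z), ?_⟩
  rw [trZ, mul_comm 2 k, pow_mul]
  linear_combination hx + hw + ε * hdet - ((p : ℤ) ^ k * (x + w) + ε) * hε_sq
end
end

section
/- For every prime p and every integer k ≥ 1, the number of triples (X, Y, Z) ∈ (ℤ/p^kℤ)³ satisfying X² + Y·Z = 0 is p^{2k} + p^{2k−1} − p^{⌊(3k−1)/2⌋}. -/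
noncomputable section

open Finset Classical in
/-- Preimages under a homomorphism of finite groups of a subset of the range are
equidistributed. -/
theorem card_preimage_mul_card_range {G H : Type*} [AddGroup G] [AddGroup H] [Fintype G]
    [Fintype H] [DecidableEq H] (g : G →+ H) (s : Finset H) (hs : ∀ h ∈ s, h ∈ g.range) :
    #{x : G | g x ∈ s} * #{h : H | h ∈ g.range} = #s * Fintype.card G := by
  have key : ∀ t : Finset H, (∀ h ∈ t, h ∈ g.range) →
      #{x : G | g x ∈ t} = #t * #{x : G | g x = 0} := by
    intro t ht
    rw [Finset.card_eq_sum_card_fiberwise (f := g) (t := t) (fun x hx => by simpa using hx)]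
    refine Finset.sum_const_nat fun h hh => ?_
    have h1 : ({x ∈ ({x : G | g x ∈ t} : Finset G) | g x = h}) = ({x : G | g x = h} : Finset G) := by
      ext x
      simp only [mem_filter, mem_univ, true_and, and_iff_right_iff_imp]
      rintro rfl
      exact hh
    rw [h1]
    exact AddMonoidHom.card_fiber_eq_of_mem_range g (ht h hh) (zero_mem g.range)
  have h2 := key {h : H | h ∈ g.range} (by simp)
  have h3 : #{x : G | g x ∈ ({h : H | h ∈ g.range} : Finset H)} = Fintype.card G := by
    simp
  rw [key s hs, ← h3, h2]
  ring

open Finset Classical in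
/-- Counting solutions of `x² + yz = 0` in a finite local ring. -/
theorem card_sq_add_mul_eq_zero (R : Type*) [CommRing R] [IsLocalRing R] [Fintype R]
    [DecidableEq R] :
    #{v : R × R × R | v.1 ^ 2 + v.2.1 * v.2.2 = 0} =
      Fintype.card R * Fintype.card Rˣ + #{x : R | ¬ IsUnit x} * Fintype.card Rˣ +
      #{v : R × R × R | (¬ IsUnit v.1 ∧ ¬ IsUnit v.2.1 ∧ ¬ IsUnit v.2.2) ∧
        v.1 ^ 2 + v.2.1 * v.2.2 = 0} := by
  have hneg (x z : R) (u : Rˣ) (h : x ^ 2 + u * z = 0) : -x ^ 2 * ↑u⁻¹ = z := by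
    have : x ^ 2 = - (u * z) := by linear_combination h
    rw [this]
    linear_combination z * u.mul_inv
  have h1 : #{v : R × R × R | IsUnit v.2.1 ∧ v.1 ^ 2 + v.2.1 * v.2.2 = 0} =
      Fintype.card R * Fintype.card Rˣ := by
    rw [← Fintype.card_prod, ← Finset.card_univ]
    symm
    refine Finset.card_bij (fun w _ => (w.1, (w.2 : R), -w.1 ^ 2 * (↑w.2⁻¹ : R))) ?_ ?_ ?_
    · rintro ⟨x, u⟩ -
      simp only [mem_filter, mem_univ, true_and, Units.isUnit]
      linear_combination -x ^ 2 * u.mul_inv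
    · rintro ⟨x, u⟩ - ⟨y, w⟩ - h
      simp only [Prod.mk.injEq, Units.val_inj] at h
      ext1
      exacts [h.1, h.2.1]
    · rintro ⟨x, y, z⟩ h
      simp only [mem_filter, mem_univ, true_and] at h
      obtain ⟨⟨u, rfl⟩, h⟩ := h
      exact ⟨(x, u), mem_univ _, by simp only [hneg x z u h]⟩
  have h2 : #{v : R × R × R | (¬ IsUnit v.2.1 ∧ IsUnit v.2.2) ∧ v.1 ^ 2 + v.2.1 * v.2.2 = 0} =
      #{x : R | ¬ IsUnit x} * Fintype.card Rˣ := by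
    rw [← Finset.card_univ, ← Finset.card_product]
    symm
    refine Finset.card_bij (fun w _ => (w.1, -w.1 ^ 2 * (↑w.2⁻¹ : R), (w.2 : R))) ?_ ?_ ?_
    · rintro ⟨x, u⟩ h
      simp only [mem_filter, mem_univ, true_and, Units.isUnit, mem_product, and_true] at h ⊢
      refine ⟨?_, by linear_combination -x ^ 2 * u.mul_inv⟩
      rw [Units.isUnit_mul_units, IsUnit.neg_iff]
      exact fun h' => h ((isUnit_pow_iff two_ne_zero).1 h')
    · rintro ⟨x, u⟩ - ⟨y, w⟩ - h
      simp only [Prod.mk.injEq, Units.val_inj] at h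
      ext1
      exacts [h.1, h.2.2]
    · rintro ⟨x, y, z⟩ h
      simp only [mem_filter, mem_univ, true_and] at h
      obtain ⟨⟨hy, ⟨u, rfl⟩⟩, h⟩ := h
      have hyx := hneg x y u (by rw [← h]; ring)
      refine ⟨(x, u), ?_, by simp only [hyx]⟩
      simp only [mem_filter, mem_univ, true_and, mem_product, and_true]
      intro hx
      exact hy (hyx ▸ ((hx.pow 2).neg.mul u⁻¹.isUnit))
  rw [← h1, ← h2, ← card_union_of_disjoint, ← card_union_of_disjoint]
  · congr 1
    ext ⟨x, y, z⟩
    simp only [mem_filter, mem_univ, true_and, mem_union]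
    constructor
    · intro h
      by_cases hy : IsUnit y
      · exact Or.inl (Or.inl ⟨hy, h⟩)
      by_cases hz : IsUnit z
      · exact Or.inl (Or.inr ⟨⟨hy, hz⟩, h⟩)
      refine Or.inr ⟨⟨fun hx => hy ?_, hy, hz⟩, h⟩
      have h' : IsUnit (y * z) := by
        rw [show y * z = -x ^ 2 by linear_combination h]
        exact (hx.pow 2).neg
      exact isUnit_of_mul_isUnit_left h'
    · tauto
  · rw [disjoint_left]
    simp only [mem_filter, mem_univ, true_and, mem_union]
    tauto
  · rw [disjoint_left]
    simp only [mem_filter, mem_univ, true_and]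
    tauto

theorem ZMod.not_isUnit_iff_dvd {p : ℕ} (hp : p.Prime) (k : ℕ) (x : ZMod (p ^ (k + 1))) :
    ¬ IsUnit x ↔ (p : ZMod (p ^ (k + 1))) ∣ x := by
  have : NeZero (p ^ (k + 1)) := ⟨(pow_pos hp.pos _).ne'⟩
  obtain ⟨n, rfl⟩ := ZMod.natCast_zmod_surjective x
  rw [ZMod.isUnit_iff_coprime, Nat.coprime_pow_right_iff k.succ_pos, Nat.coprime_comm,
    hp.coprime_iff_not_dvd, not_not]
  refine ⟨fun h => Nat.cast_dvd_cast h, ?_⟩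
  rintro ⟨c, hc⟩
  have h := congrArg (ZMod.castHom (dvd_pow_self p k.succ_ne_zero) (ZMod p)) hc
  simpa [ZMod.natCast_eq_zero_iff] using h

theorem ZMod.isLocalRing_prime_pow {p : ℕ} (hp : p.Prime) (k : ℕ) :
    IsLocalRing (ZMod (p ^ (k + 1))) := by
  have : Fact (1 < p ^ (k + 1)) := ⟨Nat.one_lt_pow k.succ_ne_zero hp.one_lt⟩
  refine IsLocalRing.of_nonunits_add fun a b ha hb => ?_
  rw [mem_nonunits_iff, ZMod.not_isUnit_iff_dvd hp] at *
  exact dvd_add ha hb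

open Finset Classical in
theorem ZMod.card_not_isUnit {p : ℕ} (hp : p.Prime) (k : ℕ) [NeZero (p ^ (k + 1))] :
    #{x : ZMod (p ^ (k + 1)) | ¬ IsUnit x} = p ^ k := by
  have h1 : #{x : ZMod (p ^ (k + 1)) | IsUnit x} = p ^ k * (p - 1) := by
    rw [← Nat.totient_prime_pow_succ hp, ← ZMod.card_units_eq_totient, ← Finset.card_univ]
    symm
    refine Finset.card_bij (fun u _ => (u : ZMod (p ^ (k + 1)))) (by simp) ?_ ?_
    · exact fun _ _ _ _ h => Units.ext h
    · rintro x hx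
      obtain ⟨u, rfl⟩ := (mem_filter.1 hx).2
      exact ⟨u, mem_univ _, rfl⟩
  have h2 := Finset.card_filter_add_card_filter_not (s := (univ : Finset (ZMod (p ^ (k + 1)))))
    (fun x => IsUnit x)
  rw [h1, Finset.card_univ, ZMod.card] at h2
  have h3 : p ^ k * (p - 1) + p ^ k = p ^ (k + 1) := by
    rw [← Nat.mul_succ, Nat.succ_eq_add_one, Nat.sub_add_cancel hp.one_le, pow_succ]
  exact Nat.add_left_cancel (h2.trans h3.symm)

open Finset Classical in
/-- If `ϖ` generates the nonunits of `R` and `c : R → S` is the quotient by the annihilator of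
`ϖ ^ 2`, then the solutions with nonunit coordinates in `R` are governed by those in `S`. -/
theorem card_nonunit_solutions_mul {R S : Type*} [CommRing R] [CommRing S] [Fintype R]
    [Fintype S] [DecidableEq R] [DecidableEq S] (c : R →+* S) (hc : Function.Surjective c)
    (ϖ : R) (hϖ : ∀ x, ¬ IsUnit x ↔ ϖ ∣ x) (hann : ∀ x, ϖ ^ 2 * x = 0 ↔ c x = 0) :
    #{v : R × R × R | (¬ IsUnit v.1 ∧ ¬ IsUnit v.2.1 ∧ ¬ IsUnit v.2.2) ∧
      v.1 ^ 2 + v.2.1 * v.2.2 = 0} * Fintype.card S ^ 3 =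
    #{v : S × S × S | v.1 ^ 2 + v.2.1 * v.2.2 = 0} * #{x : R | ¬ IsUnit x} ^ 3 := by
  let f : R × R × R →+ S × S × S :=
    c.toAddMonoidHom.prodMap (c.toAddMonoidHom.prodMap c.toAddMonoidHom)
  let m : R →+ R := AddMonoidHom.mulLeft ϖ
  let g : R × R × R →+ R × R × R := m.prodMap (m.prodMap m)
  have hg (v : R × R × R) :
      v ∈ g.range ↔ ¬ IsUnit v.1 ∧ ¬ IsUnit v.2.1 ∧ ¬ IsUnit v.2.2 := by
    simp only [hϖ]
    constructor
    · rintro ⟨w, rfl⟩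
      exact ⟨⟨_, rfl⟩, ⟨_, rfl⟩, ⟨_, rfl⟩⟩
    · rintro ⟨⟨a, ha⟩, ⟨b, hb⟩, ⟨d, hd⟩⟩
      exact ⟨(a, b, d), Prod.ext ha.symm (Prod.ext hb.symm hd.symm)⟩
  have hf (v : S × S × S) : v ∈ f.range := by
    obtain ⟨x, hx⟩ := hc v.1
    obtain ⟨y, hy⟩ := hc v.2.1
    obtain ⟨z, hz⟩ := hc v.2.2
    exact ⟨(x, y, z), Prod.ext hx (Prod.ext hy hz)⟩
  have cardf := card_preimage_mul_card_range f {v : S × S × S | v.1 ^ 2 + v.2.1 * v.2.2 = 0}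
    fun v _ => hf v
  have cardg := card_preimage_mul_card_range g {v : R × R × R |
    (¬ IsUnit v.1 ∧ ¬ IsUnit v.2.1 ∧ ¬ IsUnit v.2.2) ∧ v.1 ^ 2 + v.2.1 * v.2.2 = 0}
    fun v hv => (hg v).2 (mem_filter.1 hv).2.1
  have rangef : #{v : S × S × S | v ∈ f.range} = Fintype.card S ^ 3 := by
    simp only [hf, filter_true, Finset.card_univ, Fintype.card_prod]
    ring
  have rangeg : #{v : R × R × R | v ∈ g.range} = #{x : R | ¬ IsUnit x} ^ 3 := by
    have : ({v : R × R × R | v ∈ g.range} : Finset _) =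
        ({x : R | ¬ IsUnit x} : Finset R) ×ˢ ({x : R | ¬ IsUnit x} : Finset R) ×ˢ
          ({x : R | ¬ IsUnit x} : Finset R) := by
      ext v
      simp [hg]
    rw [this, card_product, card_product]
    ring
  have preimage_eq : #{x : R × R × R | f x ∈ ({v : S × S × S | v.1 ^ 2 + v.2.1 * v.2.2 = 0} :
      Finset (S × S × S))} = #{x : R × R × R | g x ∈ ({v : R × R × R |
      (¬ IsUnit v.1 ∧ ¬ IsUnit v.2.1 ∧ ¬ IsUnit v.2.2) ∧ v.1 ^ 2 + v.2.1 * v.2.2 = 0} :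
      Finset (R × R × R))} := by
    congr 1
    ext v
    have hv := (hg _).1 ⟨v, rfl⟩
    simp only [mem_filter, mem_univ, true_and]
    rw [and_iff_right hv]
    change c v.1 ^ 2 + c v.2.1 * c v.2.2 = 0 ↔
      (ϖ * v.1) ^ 2 + (ϖ * v.2.1) * (ϖ * v.2.2) = 0
    rw [← map_pow, ← map_mul, ← map_add, ← hann]
    ring_nf
  rw [preimage_eq, rangef] at cardf
  rw [rangeg] at cardg
  refine Nat.eq_of_mul_eq_mul_right (Fintype.card_pos (α := R × R × R)) ?_
  rw [mul_right_comm, ← cardg, mul_right_comm, cardf]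
  ring

open Finset Classical in
/-- Solutions with all coordinates divisible by `p` come from solutions modulo `p ^ k`. -/
theorem card_nonunit_solutions {p : ℕ} (hp : p.Prime) (k : ℕ) [NeZero (p ^ (k + 1 + 1))]
    [NeZero (p ^ k)] :
    #{v : ZMod (p ^ (k + 1 + 1)) × ZMod (p ^ (k + 1 + 1)) × ZMod (p ^ (k + 1 + 1)) |
      (¬ IsUnit v.1 ∧ ¬ IsUnit v.2.1 ∧ ¬ IsUnit v.2.2) ∧ v.1 ^ 2 + v.2.1 * v.2.2 = 0} =
    p ^ 3 * #{v : ZMod (p ^ k) × ZMod (p ^ k) × ZMod (p ^ k) |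
      v.1 ^ 2 + v.2.1 * v.2.2 = 0} := by
  have hpow : p ^ (k + 1 + 1) = p ^ 2 * p ^ k := by ring
  have h := card_nonunit_solutions_mul
    (ZMod.castHom (pow_dvd_pow p (by lia : k ≤ k + 1 + 1)) (ZMod (p ^ k)))
    (ZMod.castHom_surjective _) (p : ZMod (p ^ (k + 1 + 1))) (ZMod.not_isUnit_iff_dvd hp (k + 1))
    (fun x => by
      obtain ⟨n, rfl⟩ := ZMod.natCast_zmod_surjective x
      rw [map_natCast, ← Nat.cast_pow, ← Nat.cast_mul, ZMod.natCast_eq_zero_iff,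
        ZMod.natCast_eq_zero_iff, hpow]
      exact Nat.mul_dvd_mul_iff_left (pow_pos hp.pos 2))
  rw [ZMod.card, ZMod.card_not_isUnit hp] at h
  refine Nat.eq_of_mul_eq_mul_right (pow_pos (pow_pos hp.pos k) 3) (h.trans ?_)
  ring

/-- The number of solutions of `x² + yz = 0` over `ℤ/nℤ`. -/
def solutionCount (n : ℕ) : ℕ :=
  Nat.card {v : ZMod n × ZMod n × ZMod n // v.1 ^ 2 + v.2.1 * v.2.2 = 0}

open Finset Classical in
theorem solutionCount_eq (n : ℕ) [NeZero n] :
    solutionCount n = #{v : ZMod n × ZMod n × ZMod n | v.1 ^ 2 + v.2.1 * v.2.2 = 0} := by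
  rw [solutionCount, Nat.card_eq_fintype_card, Fintype.card_subtype]

theorem solutionCount_one : solutionCount 1 = 1 := by
  rw [solutionCount, Nat.card_eq_one_iff_unique]
  exact ⟨⟨fun a b => Subtype.ext (Subsingleton.elim (α := Fin 1 × Fin 1 × Fin 1) _ _)⟩,
    ⟨⟨0, by simp⟩⟩⟩

theorem solutionCount_prime {p : ℕ} (hp : p.Prime) : solutionCount (p ^ 1) = p ^ 2 := by
  classical
  have : NeZero (p ^ (0 + 1)) := ⟨(pow_pos hp.pos _).ne'⟩
  have := ZMod.isLocalRing_prime_pow hp 0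
  have h0 (x : ZMod (p ^ (0 + 1))) : ¬ IsUnit x ↔ x = 0 := by
    rw [ZMod.not_isUnit_iff_dvd hp, (ZMod.natCast_eq_zero_iff p (p ^ (0 + 1))).2 (by simp),
      zero_dvd_iff]
  have h1 : (Finset.univ.filter fun v : ZMod (p ^ (0 + 1)) × ZMod (p ^ (0 + 1)) ×
      ZMod (p ^ (0 + 1)) => (¬ IsUnit v.1 ∧ ¬ IsUnit v.2.1 ∧ ¬ IsUnit v.2.2) ∧
        v.1 ^ 2 + v.2.1 * v.2.2 = 0) = {0} := by
    ext ⟨x, y, z⟩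
    simp only [h0, Finset.mem_filter, Finset.mem_univ, true_and, Finset.mem_singleton,
      Prod.mk_eq_zero]
    constructor
    · exact And.left
    · rintro ⟨rfl, rfl, rfl⟩
      simp
  have h := card_sq_add_mul_eq_zero (ZMod (p ^ (0 + 1)))
  rw [← solutionCount_eq, ZMod.card, ZMod.card_units_eq_totient, Nat.totient_prime_pow_succ hp,
    ZMod.card_not_isUnit hp, h1, Finset.card_singleton] at h
  rw [h]
  obtain ⟨q, rfl⟩ := Nat.exists_eq_add_of_lt hp.pos
  simp only [Nat.add_sub_cancel, zero_add]
  ring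

theorem solutionCount_prime_pow_add_two {p : ℕ} (hp : p.Prime) (k : ℕ) :
    solutionCount (p ^ (k + 2)) + p ^ (2 * k + 2) =
      p ^ (2 * k + 4) + p ^ 3 * solutionCount (p ^ k) := by
  have : NeZero (p ^ (k + 1 + 1)) := ⟨(pow_pos hp.pos _).ne'⟩
  have : NeZero (p ^ k) := ⟨(pow_pos hp.pos _).ne'⟩
  have := ZMod.isLocalRing_prime_pow hp (k + 1)
  have h := card_sq_add_mul_eq_zero (ZMod (p ^ (k + 1 + 1)))
  rw [← solutionCount_eq, ZMod.card, ZMod.card_units_eq_totient, Nat.totient_prime_pow_succ hp,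
    ZMod.card_not_isUnit hp, card_nonunit_solutions hp, ← solutionCount_eq] at h
  rw [h]
  obtain ⟨q, rfl⟩ := Nat.exists_eq_add_of_lt hp.pos
  simp only [Nat.add_sub_cancel, zero_add]
  ring

theorem solutionCount_prime_pow {p : ℕ} (hp : p.Prime) (k : ℕ) :
    solutionCount (p ^ (k + 1)) + p ^ ((3 * k + 2) / 2) = p ^ (2 * k + 2) + p ^ (2 * k + 1) := by
  induction k using Nat.strong_induction_on with
  | _ k ih =>
    match k with
    | 0 => simp [← solutionCount_prime hp]
    | 1 =>
      have h := solutionCount_prime_pow_add_two hp 0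
      rw [pow_zero, solutionCount_one] at h
      norm_num at h ⊢
      exact h
    | k + 2 =>
      have h := solutionCount_prime_pow_add_two hp (k + 1)
      have h' := congrArg (p ^ 3 * ·) (ih k (by lia))
      rw [show (3 * (k + 2) + 2) / 2 = (3 * k + 2) / 2 + 3 by lia]
      rw [show k + 1 + 2 = k + 2 + 1 by ring] at h
      ring_nf at h h' ⊢
      linarith

/-- For every prime `p` and every `k ≥ 1`, the number of triples
`(X,Y,Z) ∈ (ℤ/p^kℤ)³` with `X² + YZ = 0` is `p^{2k} + p^{2k-1} - p^{⌊(3k-1)/2⌋}`. -/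
theorem statement17 (p : ℕ) (hp : p.Prime) (k : ℕ) (hk : 1 ≤ k) :
    Nat.card {v : ZMod (p ^ k) × ZMod (p ^ k) × ZMod (p ^ k) //
        v.1 ^ 2 + v.2.1 * v.2.2 = 0} =
      p ^ (2 * k) + p ^ (2 * k - 1) - p ^ ((3 * k - 1) / 2) := by
  obtain ⟨k, rfl⟩ := Nat.exists_eq_add_of_le' hk
  exact Nat.eq_sub_of_add_eq (solutionCount_prime_pow hp k)
end
end

section
/- Let p be an odd prime and let α ≥ 0, β ≥ 0 be integers with (α, β) ≠ (0, 0). Let N be the number of matrices γ ∈ SL(2, ℤ/p^{2(α+β)}ℤ) such that γ ≡ I₂ or γ ≡ −I₂ (mod p^α) and Tr(γ) = 2 or Tr(γ) = −2 in ℤ/p^{2(α+β)}ℤ. Then p·N = 2 p^{3α} (p^{4β+1} + p^{4β} − p^{3β}); that is, N = 2 p^{3α}(p^{4β} + p^{4β−1} − p^{3β−1}) for β ≥ 1, and N = 2 p^{3α} for β = 0. -/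
noncomputable section

open Matrix

/-- The points of the cone `x² + y z = 0` over `R` all of whose coordinates are multiples
of `d`. -/
def conePoints {R : Type*} [CommRing R] (d : R) : Set (R × R × R) :=
  {v | d ∣ v.1 ∧ d ∣ v.2.1 ∧ d ∣ v.2.2 ∧ v.1 ^ 2 + v.2.1 * v.2.2 = 0}

lemma natCast_dvd_iff_dvd_val {n d : ℕ} [NeZero n] (h : d ∣ n) (t : ZMod n) :
    (d : ZMod n) ∣ t ↔ d ∣ t.val := by
  constructor
  · rintro ⟨s, rfl⟩
    rw [ZMod.val_mul, Nat.dvd_mod_iff h, ZMod.val_natCast]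
    exact Dvd.dvd.mul_right ((Nat.dvd_mod_iff h).2 dvd_rfl) _
  · intro h
    have := Nat.cast_dvd_cast (α := ZMod n) h
    rwa [ZMod.natCast_zmod_val] at this

lemma castHom_eq_zero_iff_dvd {n d : ℕ} [NeZero n] (h : d ∣ n) (t : ZMod n) :
    ZMod.castHom h (ZMod d) t = 0 ↔ (d : ZMod n) ∣ t := by
  rw [natCast_dvd_iff_dvd_val h, ← ZMod.natCast_eq_zero_iff, ZMod.castHom_apply,
    ZMod.natCast_val]

lemma not_isUnit_iff_prime_dvd {p k : ℕ} (hp : p.Prime) (hk : k ≠ 0) (t : ZMod (p ^ k)) :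
    ¬ IsUnit t ↔ (p : ZMod (p ^ k)) ∣ t := by
  have : NeZero (p ^ k) := ⟨pow_ne_zero _ hp.ne_zero⟩
  rw [natCast_dvd_iff_dvd_val (dvd_pow_self p hk), ← ZMod.natCast_zmod_val t,
    ZMod.isUnit_iff_coprime, Nat.coprime_pow_right_iff (Nat.pos_of_ne_zero hk),
    Nat.coprime_comm, hp.coprime_iff_not_dvd, not_not, ZMod.natCast_zmod_val]

/-- The multiple `p ^ a * (y + p ^ j * t)` of `p ^ a`, built from its base-`p` digits. -/
def scaledLift (p a j : ℕ) (u : ZMod (p ^ j) × Fin (p ^ a)) : ℕ :=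
  p ^ a * (u.1.val + p ^ j * u.2)

lemma scaledLift_lt {p : ℕ} (hp : p.Prime) (a j : ℕ) (u : ZMod (p ^ j) × Fin (p ^ a)) :
    scaledLift p a j u < p ^ (2 * a + j) := by
  have : NeZero (p ^ j) := ⟨pow_ne_zero _ hp.ne_zero⟩
  have h1 := ZMod.val_lt u.1
  have h2 := u.2.2
  have h3 : u.1.val + p ^ j * u.2 < p ^ j * p ^ a := by nlinarith
  have h4 : p ^ (2 * a + j) = p ^ a * (p ^ j * p ^ a) := by ring
  rw [h4, scaledLift]
  exact Nat.mul_lt_mul_of_pos_left h3 (pow_pos hp.pos _)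

lemma scaledLift_injective {p : ℕ} (hp : p.Prime) (a j : ℕ) :
    Function.Injective (scaledLift p a j) := by
  have : NeZero (p ^ j) := ⟨pow_ne_zero _ hp.ne_zero⟩
  rintro ⟨y, t⟩ ⟨y', t'⟩ h
  have h := Nat.eq_of_mul_eq_mul_left (pow_pos hp.pos a) h
  have hy : y = y' := by
    apply ZMod.val_injective
    have := congrArg (· % p ^ j) h
    simpa [Nat.mod_eq_of_lt (ZMod.val_lt _)] using this
  subst hy
  have := Nat.eq_of_mul_eq_mul_left (pow_pos hp.pos j) (Nat.add_left_cancel h)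
  exact Prod.ext rfl (Fin.ext this)

lemma exists_scaledLift_eq {p : ℕ} (hp : p.Prime) (a j : ℕ) (x : ZMod (p ^ (2 * a + j)))
    (hx : (p : ZMod (p ^ (2 * a + j))) ^ a ∣ x) :
    ∃ u, (scaledLift p a j u : ZMod (p ^ (2 * a + j))) = x := by
  have : NeZero (p ^ (2 * a + j)) := ⟨pow_ne_zero _ hp.ne_zero⟩
  have hpj : 0 < p ^ j := pow_pos hp.pos _
  have : NeZero (p ^ j) := ⟨hpj.ne'⟩
  rw [← Nat.cast_pow, natCast_dvd_iff_dvd_val (pow_dvd_pow p (by omega))] at hx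
  obtain ⟨m, hm⟩ := hx
  have hlt : m / p ^ j < p ^ a := by
    rw [Nat.div_lt_iff_lt_mul hpj]
    have h4 : p ^ (2 * a + j) = p ^ a * (p ^ a * p ^ j) := by ring
    have := ZMod.val_lt x
    rw [hm, h4] at this
    exact lt_of_mul_lt_mul_left this (Nat.zero_le _)
  refine ⟨((m : ZMod (p ^ j)), ⟨m / p ^ j, hlt⟩), ?_⟩
  rw [scaledLift, ZMod.val_natCast, Nat.mod_add_div, ← hm, ZMod.natCast_zmod_val]

lemma scaledLift_cone_iff {p : ℕ} (hp : p.Prime) (a j : ℕ)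
    (u v w : ZMod (p ^ j) × Fin (p ^ a)) :
    (scaledLift p a j u : ZMod (p ^ (2 * a + j))) ^ 2 +
        scaledLift p a j v * scaledLift p a j w = 0 ↔
      u.1 ^ 2 + v.1 * w.1 = 0 := by
  have : NeZero (p ^ j) := ⟨pow_ne_zero _ hp.ne_zero⟩
  have hl (s : ZMod (p ^ j) × Fin (p ^ a)) :
      ((s.1.val + p ^ j * s.2 : ℕ) : ZMod (p ^ j)) = s.1 := by
    rw [Nat.cast_add, Nat.cast_mul, ZMod.natCast_self, zero_mul, add_zero,
      ZMod.natCast_zmod_val]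
  conv_rhs => rw [← hl u, ← hl v, ← hl w]
  simp only [scaledLift]
  norm_cast
  rw [ZMod.natCast_eq_zero_iff, ZMod.natCast_eq_zero_iff]
  rw [show p ^ (2 * a + j) = (p ^ a * p ^ a) * p ^ j by ring]
  rw [← Nat.mul_dvd_mul_iff_left (mul_pos (pow_pos hp.pos a) (pow_pos hp.pos a))
    (b := p ^ j)]
  ring_nf

lemma card_conePoints_pow {p : ℕ} (hp : p.Prime) (a j : ℕ) :
    Nat.card (conePoints ((p : ZMod (p ^ (2 * a + j))) ^ a)) =
      p ^ (3 * a) * Nat.card (conePoints (1 : ZMod (p ^ j))) := by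
  let F := Fin (p ^ a)
  let f : conePoints (1 : ZMod (p ^ j)) × F × F × F →
      conePoints ((p : ZMod (p ^ (2 * a + j))) ^ a) := fun q =>
    ⟨((scaledLift p a j (q.1.1.1, q.2.1) : ℕ), (scaledLift p a j (q.1.1.2.1, q.2.2.1) : ℕ),
      (scaledLift p a j (q.1.1.2.2, q.2.2.2) : ℕ)), by
      refine ⟨?_, ?_, ?_, (scaledLift_cone_iff hp a j _ _ _).2 q.1.2.2.2.2⟩ <;>
      simp [scaledLift]⟩
  have hinj {u v : ZMod (p ^ j) × F}
      (h : (scaledLift p a j u : ZMod (p ^ (2 * a + j))) = scaledLift p a j v) : u = v := by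
    apply scaledLift_injective hp
    rw [ZMod.natCast_eq_natCast_iff'] at h
    rwa [Nat.mod_eq_of_lt (scaledLift_lt hp a j u),
      Nat.mod_eq_of_lt (scaledLift_lt hp a j v)] at h
  have hf : Function.Bijective f := by
    constructor
    · rintro ⟨⟨⟨x, y, z⟩, h⟩, r, s, t⟩ ⟨⟨⟨x', y', z'⟩, h'⟩, r', s', t'⟩ heq
      have h1 : (x, r) = (x', r') := hinj (congrArg (fun v => v.1.1) heq)
      have h2 : (y, s) = (y', s') := hinj (congrArg (fun v => v.1.2.1) heq)
      have h3 : (z, t) = (z', t') := hinj (congrArg (fun v => v.1.2.2) heq)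
      simp only [Prod.mk.injEq] at h1 h2 h3
      obtain ⟨⟨rfl, rfl⟩, ⟨rfl, rfl⟩, ⟨rfl, rfl⟩⟩ := And.intro h1 (And.intro h2 h3)
      rfl
    · rintro ⟨⟨x, y, z⟩, hx, hy, hz, h⟩
      obtain ⟨u, rfl⟩ := exists_scaledLift_eq hp a j x hx
      obtain ⟨v, rfl⟩ := exists_scaledLift_eq hp a j y hy
      obtain ⟨w, rfl⟩ := exists_scaledLift_eq hp a j z hz
      exact ⟨⟨⟨(u.1, v.1, w.1), one_dvd _, one_dvd _, one_dvd _,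
        (scaledLift_cone_iff hp a j u v w).1 h⟩, u.2, v.2, w.2⟩, rfl⟩
  rw [← Nat.card_eq_of_bijective f hf]
  simp only [Nat.card_prod, F, Nat.card_fin]
  ring

lemma card_zmod_units {p k : ℕ} (hp : p.Prime) :
    Nat.card (ZMod (p ^ (k + 1)))ˣ = p ^ k * (p - 1) := by
  have : NeZero (p ^ (k + 1)) := ⟨pow_ne_zero _ hp.ne_zero⟩
  rw [Nat.card_eq_fintype_card, ZMod.card_units_eq_totient, Nat.totient_prime_pow_succ hp]

lemma card_zmod_nonunits {p k : ℕ} (hp : p.Prime) :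
    Nat.card {x : ZMod (p ^ (k + 1)) // ¬ IsUnit x} = p ^ k := by
  have : NeZero (p ^ (k + 1)) := ⟨pow_ne_zero _ hp.ne_zero⟩
  have h := Nat.card_congr (Equiv.sumCompl fun x : ZMod (p ^ (k + 1)) => IsUnit x)
  have hu : Function.Bijective
      fun u : (ZMod (p ^ (k + 1)))ˣ => (⟨u, u.isUnit⟩ : {x : ZMod (p ^ (k + 1)) // IsUnit x}) :=
    ⟨fun _ _ h => Units.ext (congrArg Subtype.val h), fun ⟨_, u, hu⟩ => ⟨u, Subtype.ext hu⟩⟩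
  rw [Nat.card_sum, Nat.card_zmod, ← Nat.card_eq_of_bijective _ hu, card_zmod_units hp] at h
  have : p ^ (k + 1) = p ^ k * (p - 1) + p ^ k := by
    obtain ⟨q, rfl⟩ := Nat.exists_eq_succ_of_ne_zero hp.ne_zero
    simp [pow_succ]; ring
  omega

section
variable {R : Type*} [CommRing R]

/-- Points of the cone whose second coordinate is a unit, the first one satisfying `P`,
are parametrised by their first two coordinates. -/
def coneUnitEquiv (P : R → Prop) :
    {v : R × R × R // P v.1 ∧ IsUnit v.2.1 ∧ v.1 ^ 2 + v.2.1 * v.2.2 = 0} ≃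
      {x : R // P x} × Rˣ where
  toFun v := (⟨v.1.1, v.2.1⟩, v.2.2.1.unit)
  invFun q := ⟨(q.1, q.2, -(q.1.1 ^ 2 * (q.2⁻¹ : Rˣ))), q.1.2, q.2.isUnit, by
    linear_combination (-q.1.1 ^ 2) * q.2.mul_inv⟩
  left_inv := by
    rintro ⟨⟨x, y, z⟩, hP, hy, h⟩
    ext
    · rfl
    · rfl
    · change -(x ^ 2 * (hy.unit⁻¹ : Rˣ)) = z
      have h' : x ^ 2 + y * z = 0 := h
      have hu : y * (hy.unit⁻¹ : Rˣ) = 1 := hy.mul_val_inv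
      linear_combination (-(hy.unit⁻¹ : Rˣ) : R) * h' + z * hu
  right_inv q := by ext <;> simp

end

lemma card_conePoints_succ {p k : ℕ} (hp : p.Prime) :
    Nat.card (conePoints (1 : ZMod (p ^ (k + 1)))) =
      p ^ (k + 1) * (p ^ k * (p - 1)) + p ^ k * (p ^ k * (p - 1)) +
        Nat.card (conePoints (p : ZMod (p ^ (k + 1)))) := by
  have : NeZero (p ^ (k + 1)) := ⟨pow_ne_zero _ hp.ne_zero⟩
  let R := ZMod (p ^ (k + 1))
  have hd (t : R) : (p : R) ∣ t ↔ ¬ IsUnit t := (not_isUnit_iff_prime_dvd hp k.succ_ne_zero t).symm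
  let A : Set (R × R × R) := {v | True ∧ IsUnit v.2.1 ∧ v.1 ^ 2 + v.2.1 * v.2.2 = 0}
  let B : Set (R × R × R) := {v | ¬ IsUnit v.1 ∧ IsUnit v.2.2 ∧ v.1 ^ 2 + v.2.2 * v.2.1 = 0}
  have hA : A.ncard = p ^ (k + 1) * (p ^ k * (p - 1)) := by
    have e : A ≃ {v : R × R × R // True ∧ IsUnit v.2.1 ∧ v.1 ^ 2 + v.2.1 * v.2.2 = 0} :=
      Equiv.subtypeEquivRight fun _ => Iff.rfl
    rw [← Nat.card_coe_set_eq, Nat.card_congr e,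
      Nat.card_congr (coneUnitEquiv fun _ : R => True), Nat.card_prod,
      card_zmod_units hp, Nat.card_congr (Equiv.subtypeUnivEquiv fun _ => trivial), Nat.card_zmod]
  have hB : B.ncard = p ^ k * (p ^ k * (p - 1)) := by
    rw [← Nat.card_coe_set_eq]
    have e : B ≃ {v : R × R × R // ¬ IsUnit v.1 ∧ IsUnit v.2.1 ∧
        v.1 ^ 2 + v.2.1 * v.2.2 = 0} :=
      (Equiv.prodCongr (Equiv.refl R) (Equiv.prodComm R R)).subtypeEquiv fun _ => Iff.rfl
    rw [Nat.card_congr e, Nat.card_congr (coneUnitEquiv fun x : R => ¬ IsUnit x), Nat.card_prod,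
      card_zmod_units hp, card_zmod_nonunits hp]
  have hx {x y z : R} (h : x ^ 2 + y * z = 0) (hu : IsUnit x) : IsUnit y := by
    have : IsUnit (y * -z) := by
      rw [show y * -z = x ^ 2 by linear_combination -h]
      exact hu.pow 2
    exact isUnit_of_mul_isUnit_left this
  have hU : conePoints (1 : R) = (A ∪ B) ∪ conePoints (p : R) := by
    ext ⟨x, y, z⟩
    simp only [conePoints, A, B, Set.mem_ofPred_eq, Set.mem_union, hd, one_dvd,
      true_and, mul_comm z y]
    have := @hx x y z
    tauto
  have hAB : Disjoint A B := by
    rw [Set.disjoint_left]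
    rintro ⟨x, y, z⟩ ⟨-, hy, h⟩ ⟨hx, hz, -⟩
    apply hx
    have : IsUnit (x ^ 2) := by
      rw [show x ^ 2 = -(y * z) by linear_combination h]
      exact (hy.mul hz).neg
    exact (isUnit_pow_iff two_ne_zero).1 this
  have hABC : Disjoint (A ∪ B) (conePoints (p : R)) := by
    rw [Set.disjoint_left]
    rintro ⟨x, y, z⟩ h ⟨-, hy, hz, -⟩
    rw [hd] at hy hz
    rcases h with h | h
    · exact hy h.2.1
    · exact hz h.2.1
  rw [Nat.card_coe_set_eq, Nat.card_coe_set_eq]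
  change (conePoints (1 : R)).ncard = _
  rw [hU, Set.ncard_union_eq hABC, Set.ncard_union_eq hAB, hA, hB]

lemma prime_mul_card_conePoints {p : ℕ} (hp : p.Prime) (β : ℕ) :
    p * Nat.card (conePoints (1 : ZMod (p ^ (2 * β)))) + p ^ (3 * β) =
      p ^ (4 * β + 1) + p ^ (4 * β) := by
  induction β with
  | zero =>
    have : Nat.card (conePoints (1 : ZMod (p ^ (2 * 0)))) = 1 := by
      have : Subsingleton (ZMod (p ^ (2 * 0))) := by
        rw [mul_zero, pow_zero]; infer_instance
      rw [Nat.card_eq_one_iff_unique]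
      exact ⟨inferInstance, ⟨0, one_dvd _, one_dvd _, one_dvd _, Subsingleton.elim _ _⟩⟩
    rw [this]; simp
  | succ β ih =>
    have h1 := card_conePoints_succ (k := 2 * β + 1) hp
    have h2 := card_conePoints_pow hp 1 (2 * β)
    rw [pow_one] at h2
    have h3 : 2 * 1 + 2 * β = 2 * β + 1 + 1 := by ring
    rw [h3] at h2
    rw [h2] at h1
    rw [show 2 * (β + 1) = 2 * β + 1 + 1 by ring, h1]
    obtain ⟨q, rfl⟩ := Nat.exists_eq_succ_of_ne_zero hp.ne_zero
    rw [Nat.succ_eq_add_one, Nat.add_sub_cancel] at *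
    generalize Nat.card (conePoints (1 : ZMod ((q + 1) ^ (2 * β)))) = M at *
    linear_combination (q + 1) ^ 3 * ih

/-- Elements of `SL₂` of trace two congruent to the identity modulo `d`. -/
def congruentTraceTwo {n : ℕ} (d : ℕ) (h : d ∣ n) : Set (SpecialLinearGroup (Fin 2) (ZMod n)) :=
  {γ | (γ : Matrix (Fin 2) (Fin 2) (ZMod n)).map (ZMod.castHom h (ZMod d)) = 1 ∧
    trace (γ : Matrix (Fin 2) (Fin 2) (ZMod n)) = 2}

lemma card_congruentTraceTwo {n : ℕ} [NeZero n] (d : ℕ) (h : d ∣ n) :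
    Nat.card (congruentTraceTwo d h) = Nat.card (conePoints (d : ZMod n)) := by
  have hm (M : Matrix (Fin 2) (Fin 2) (ZMod n)) : M.map (ZMod.castHom h (ZMod d)) = 1 ↔
      (d : ZMod n) ∣ M 0 0 - 1 ∧ (d : ZMod n) ∣ M 0 1 ∧ (d : ZMod n) ∣ M 1 0 ∧
        (d : ZMod n) ∣ M 1 1 - 1 := by
    simp only [← castHom_eq_zero_iff_dvd h, map_sub, map_one, sub_eq_zero, ← Matrix.ext_iff,
      Fin.forall_fin_two, map_apply, one_apply_eq, ne_eq, zero_ne_one, one_ne_zero,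
      not_false_eq_true, one_apply_ne, and_assoc]
  refine Nat.card_congr
    { toFun := fun γ => ⟨(γ.1 0 0 - 1, γ.1 0 1, γ.1 1 0), ?_⟩
      invFun := fun v => ⟨⟨!![1 + v.1.1, v.1.2.1; v.1.2.2, 1 - v.1.1], ?_⟩, ?_⟩
      left_inv := ?_
      right_inv := ?_ }
  · obtain ⟨γ, h1, h2⟩ := γ
    have h3 := γ.det_coe
    rw [hm] at h1
    rw [trace_fin_two] at h2
    rw [det_fin_two] at h3
    refine ⟨h1.1, h1.2.1, h1.2.2.1, ?_⟩
    change (γ.1 0 0 - 1) ^ 2 + γ.1 0 1 * γ.1 1 0 = 0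
    linear_combination γ.1 0 0 * h2 - h3
  · obtain ⟨v, -, -, -, hv⟩ := v
    rw [det_fin_two_of]
    linear_combination -hv
  · obtain ⟨⟨x, y, z⟩, hx, hy, hz, hv⟩ := v
    refine ⟨(hm _).2 ?_, ?_⟩
    · simp_all
    · simp [trace_fin_two]; norm_num
  · rintro ⟨γ, h1, h2⟩
    rw [trace_fin_two] at h2
    ext i j
    fin_cases i <;> fin_cases j <;> simp
    linear_combination -h2
  · rintro ⟨⟨x, y, z⟩, hv⟩
    simp

lemma two_ne_neg_two {p k : ℕ} (hp : p.Prime) (hp2 : p ≠ 2) (hk : k ≠ 0) :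
    (2 : ZMod (p ^ k)) ≠ -2 := by
  intro h
  have h4 : ((2 ^ 2 : ℕ) : ZMod (p ^ k)) = 0 := by
    push_cast
    linear_combination h
  rw [ZMod.natCast_eq_zero_iff] at h4
  exact hp2 ((Nat.prime_dvd_prime_iff_eq hp Nat.prime_two).1
    (hp.dvd_of_dvd_pow ((dvd_pow_self p hk).trans h4)))

/-- Let `p` be an odd prime and `α, β ≥ 0` with `(α,β) ≠ (0,0)`. Let `N` be the number
of `γ ∈ SL(2, ℤ/p^{2(α+β)}ℤ)` with `γ ≡ ±I₂ (mod p^α)` and `Tr(γ) = ±2` in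
`ℤ/p^{2(α+β)}ℤ`. Then `p·N = 2·p^{3α}(p^{4β+1} + p^{4β} - p^{3β})`. -/
theorem statement18 (p : ℕ) (hp : p.Prime) (hp2 : p ≠ 2) (α β : ℕ)
    (hαβ : (α, β) ≠ (0, 0)) :
    p * Nat.card {γ : Matrix.SpecialLinearGroup (Fin 2) (ZMod (p ^ (2 * (α + β)))) //
        (((γ : Matrix (Fin 2) (Fin 2) (ZMod (p ^ (2 * (α + β))))).map
            (ZMod.castHom (pow_dvd_pow p (by omega : α ≤ 2 * (α + β))) (ZMod (p ^ α))) =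
              (1 : Matrix (Fin 2) (Fin 2) (ZMod (p ^ α)))) ∨
         ((γ : Matrix (Fin 2) (Fin 2) (ZMod (p ^ (2 * (α + β))))).map
            (ZMod.castHom (pow_dvd_pow p (by omega : α ≤ 2 * (α + β))) (ZMod (p ^ α))) =
              (-1 : Matrix (Fin 2) (Fin 2) (ZMod (p ^ α))))) ∧
        (Matrix.trace (γ : Matrix (Fin 2) (Fin 2) (ZMod (p ^ (2 * (α + β))))) = 2 ∨
         Matrix.trace (γ : Matrix (Fin 2) (Fin 2) (ZMod (p ^ (2 * (α + β))))) = -2)} =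
      2 * p ^ (3 * α) * (p ^ (4 * β + 1) + p ^ (4 * β) - p ^ (3 * β)) := by
  have hn : 2 * (α + β) ≠ 0 := by
    intro h
    exact hαβ (Prod.ext (by dsimp only; omega) (by dsimp only; omega))
  have : NeZero (p ^ (2 * (α + β))) := ⟨pow_ne_zero _ hp.ne_zero⟩
  have hle : α ≤ 2 * (α + β) := by omega
  set S := congruentTraceTwo (p ^ α) (pow_dvd_pow p hle) with hS
  have hcard : S.ncard = p ^ (3 * α) * Nat.card (conePoints (1 : ZMod (p ^ (2 * β)))) := by
    rw [← Nat.card_coe_set_eq, card_congruentTraceTwo, ← card_conePoints_pow hp, mul_add,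
      Nat.cast_pow]
  have hneg : (-S).ncard = S.ncard := by
    rw [← Set.image_neg_eq_neg, Set.ncard_image_of_injective _ neg_injective]
  have hdisj : Disjoint S (-S) := by
    rw [Set.disjoint_left]
    rintro γ ⟨-, h⟩ ⟨-, h'⟩
    rw [SpecialLinearGroup.coe_neg, trace_neg, h] at h'
    exact two_ne_neg_two hp hp2 hn h'.symm
  have key : ∀ γ : SpecialLinearGroup (Fin 2) (ZMod (p ^ (2 * (α + β)))),
      (((γ.1.map (ZMod.castHom (pow_dvd_pow p hle) (ZMod (p ^ α))) = 1) ∨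
        (γ.1.map (ZMod.castHom (pow_dvd_pow p hle) (ZMod (p ^ α))) = -1)) ∧
        (trace γ.1 = 2 ∨ trace γ.1 = -2)) ↔ γ ∈ S ∪ -S := by
    intro γ
    have hmap : (-γ.1).map (ZMod.castHom (pow_dvd_pow p hle) (ZMod (p ^ α))) =
        -γ.1.map (ZMod.castHom (pow_dvd_pow p hle) (ZMod (p ^ α))) :=
      Matrix.map_neg _ (map_neg _) _
    have hmem : γ ∈ S ∪ -S ↔
        (γ.1.map (ZMod.castHom (pow_dvd_pow p hle) (ZMod (p ^ α))) = 1 ∧ trace γ.1 = 2) ∨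
        (γ.1.map (ZMod.castHom (pow_dvd_pow p hle) (ZMod (p ^ α))) = -1 ∧ trace γ.1 = -2) := by
      rw [Set.mem_union, Set.mem_neg]
      simp only [hS, congruentTraceTwo, Set.mem_ofPred_eq, SpecialLinearGroup.coe_neg, trace_neg,
        hmap, neg_eq_iff_eq_neg]
    rw [hmem]
    rcases eq_or_ne α 0 with rfl | hα
    · have : Subsingleton (ZMod (p ^ 0)) := by rw [pow_zero]; infer_instance
      simp only [eq_iff_true_of_subsingleton, true_or, true_and]
    · have htr := AddMonoidHom.map_trace
        (ZMod.castHom (pow_dvd_pow p hle) (ZMod (p ^ α))) γ.1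
      have hne := two_ne_neg_two hp hp2 hα
      constructor
      · rintro ⟨h1 | h1, h2 | h2⟩
        · exact Or.inl ⟨h1, h2⟩
        · rw [h1, h2] at htr
          rw [map_neg, map_ofNat, trace_one, Fintype.card_fin] at htr
          exact absurd htr.symm hne
        · rw [h1, h2] at htr
          rw [map_ofNat, trace_neg, trace_one, Fintype.card_fin] at htr
          exact absurd htr hne
        · exact Or.inr ⟨h1, h2⟩
      · tauto
  have hN := (Nat.card_congr (Equiv.subtypeEquivRight key)).trans
    (Nat.card_coe_set_eq (S ∪ -S))
  rw [Set.ncard_union_eq hdisj, hneg, hcard] at hN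
  rw [← prime_mul_card_conePoints hp β, Nat.add_sub_cancel]
  refine (congrArg (p * ·) hN).trans ?_
  ring
end
end
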